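/- arXiv:math/0202038 — 2 statements merged into one kernel-verified Lean document; each statement's English description precedes it below -/
import Mathlib

section
/- Let n ≥ 3 and suppose the hypersurface h = 0 has isolated singularities. Let {-,-} be a Poisson bracket on O = A/(h) and let P be a prime ideal of O. Then there exist a family p : Fin n → Fin n → Fin n → A_{P'}, alternating under permutations of its three indices, and a family q : Fin n → Fin n → Fin n → Fin n → A_{P'} such that, defining B : A_{P'} × A_{P'} → A_{P'} by B(F,G) = Σ_{i,j,k} p i j k · ∂ᵢF · ∂ⱼG · ∂ₖh, one has: (i) for all F, G ∈ A, loc({[F],[G]}) equals the image in O_P of B evaluated at the images of F and G in A_{P'}; and (ii) for all F₁, F₂, F₃ ∈ A_{P'}, B(B(F₁,F₂),F₃) + B(B(F₂,F₃),F₁) + B(B(F₃,F₁),F₂) = h · Σ_{i,j,k,l} q i j k l · ∂ᵢF₁ · ∂ⱼF₂ · ∂ₖF₃ · ∂ₗh (where h and ∂ₖh are taken via their images in A_{P'}). -/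
open MvPolynomial

/-- A Poisson bracket on a commutative `ℂ`-algebra `R`: a `ℂ`-bilinear map which is
antisymmetric, a derivation in each argument, and satisfies the Jacobi identity. -/
def IsPoissonBracket {R : Type*} [CommRing R] [Algebra ℂ R] (br : R → R → R) : Prop :=
  (∀ (c : ℂ) (f g k : R), br (c • f + g) k = c • br f k + br g k) ∧
  (∀ (c : ℂ) (f g k : R), br f (c • g + k) = c • br f g + br f k) ∧
  (∀ f g : R, br f g = - br g f) ∧
  (∀ f g k : R, br f (g * k) = br f g * k + g * br f k) ∧
  (∀ f g k : R, br (f * g) k = br f k * g + f * br g k) ∧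
  (∀ f g k : R, br f (br g k) + br g (br k f) + br k (br f g) = 0)

section Koszul

variable {R M N : Type*} [CommRing R] [AddCommGroup M] [Module R M] [AddCommGroup N] [Module R N]

/-- The Koszul complex whose terms are the alternating forms on `M` and whose differential is the
contraction with `f : M` has no homology in degrees larger than `s`. -/
def KoszulExactAbove (R : Type*) {M : Type*} [CommRing R] [AddCommGroup M] [Module R M]
    (f : M) (s : ℕ) : Prop :=
  ∀ k, s ≤ k → ∀ ω : M [⋀^Fin (k + 1)]→ₗ[R] R, ω.curryLeft f = 0 →
    ∃ η : M [⋀^Fin (k + 2)]→ₗ[R] R, η.curryLeft f = ω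

theorem KoszulExactAbove.map_equiv {f : M} {s : ℕ} {g : N} (H : KoszulExactAbove R f s)
    (e : M ≃ₗ[R] N) (hg : e f = g) : KoszulExactAbove R g s := by
  subst hg
  intro k hk ω hω
  obtain ⟨η, hη⟩ := H k hk (ω.compLinearMap e.toLinearMap) (by
    rw [AlternatingMap.curryLeft_compLinearMap]
    simp [hω])
  refine ⟨η.compLinearMap e.symm.toLinearMap, ?_⟩
  rw [AlternatingMap.curryLeft_compLinearMap]
  simp only [LinearEquiv.coe_coe, LinearEquiv.symm_apply_apply, hη]
  ext v
  simp

theorem KoszulExactAbove.of_subsingleton [Subsingleton M] (f : M) :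
    KoszulExactAbove R f 0 := by
  intro k _ ω _
  refine ⟨0, ?_⟩
  ext v
  simpa using (ω.map_coord_zero 0 (Subsingleton.elim _ _)).symm

/-- The exterior product of the last coordinate form on `M × R` with the pullback of `γ`. -/
def wedgeSnd {k : ℕ} (γ : M [⋀^Fin k]→ₗ[R] R) : (M × R) [⋀^Fin (k + 1)]→ₗ[R] R :=
  AlternatingMap.alternatizeUncurryFin
    ((LinearMap.snd R M R).smulRight (γ.compLinearMap (LinearMap.fst R M R)))

theorem wedgeSnd_curryLeft {k : ℕ} (γ : M [⋀^Fin (k + 1)]→ₗ[R] R) (f : M) (a : R) :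
    (wedgeSnd γ).curryLeft (f, a) =
      a • γ.compLinearMap (LinearMap.fst R M R) - wedgeSnd (γ.curryLeft f) := by
  ext v
  simp only [AlternatingMap.curryLeft_apply_apply, wedgeSnd,
    AlternatingMap.alternatizeUncurryFin_apply, AlternatingMap.sub_apply]
  rw [Fin.sum_univ_succ, sub_eq_add_neg, ← Finset.sum_neg_distrib]
  congr 1
  · simp [Matrix.vecCons]
  · refine Finset.sum_congr rfl fun i _ => ?_
    have : (fun j => LinearMap.fst R M R (i.succ.removeNth (Matrix.vecCons (f, a) v) j)) =
        Matrix.vecCons f (fun j => LinearMap.fst R M R (i.removeNth v j)) := by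
      ext j
      refine Fin.cases ?_ (fun j => ?_) j <;> simp [Fin.removeNth, Matrix.vecCons]
    simp only [LinearMap.smulRight_apply, AlternatingMap.smul_apply,
      AlternatingMap.compLinearMap_apply, AlternatingMap.curryLeft_apply_apply]
    rw [this]
    simp [pow_succ, Matrix.vecCons]

theorem wedgeSnd_zero {k : ℕ} : wedgeSnd (0 : M [⋀^Fin k]→ₗ[R] R) = 0 := by
  ext v
  simp [wedgeSnd, AlternatingMap.alternatizeUncurryFin_apply]

theorem wedgeSnd_curryLeft_snd {k : ℕ} (γ : M [⋀^Fin k]→ₗ[R] R) :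
    (wedgeSnd γ).curryLeft (0, 1) = γ.compLinearMap (LinearMap.fst R M R) := by
  cases k with
  | zero =>
    ext v
    simp [wedgeSnd, AlternatingMap.alternatizeUncurryFin_apply]
  | succ k => simp [wedgeSnd_curryLeft, wedgeSnd_zero]

theorem wedgeSnd_compLinearMap_inl {k : ℕ} (γ : M [⋀^Fin k]→ₗ[R] R) :
    (wedgeSnd γ).compLinearMap (LinearMap.inl R M R) = 0 := by
  ext v
  simp [wedgeSnd, AlternatingMap.alternatizeUncurryFin_apply]

theorem AlternatingMap.curryLeft_swap {k : ℕ} (ω : M [⋀^Fin (k + 2)]→ₗ[R] N) (x y : M) :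
    (ω.curryLeft x).curryLeft y = -(ω.curryLeft y).curryLeft x := by
  have h1 := ω.curryLeft_same (x + y)
  simp only [map_add, AlternatingMap.curryLeft_add, LinearMap.add_apply,
    AlternatingMap.curryLeft_same] at h1
  rw [eq_neg_iff_add_eq_zero]
  simpa [add_comm] using h1

/-- A form on `M × R` killed by contraction with the last basis vector is pulled back from `M`. -/
theorem eq_pullback_of_curryLeft_eq_zero {k : ℕ} (ω : (M × R) [⋀^Fin (k + 1)]→ₗ[R] R)
    (hω : ω.curryLeft (0, 1) = 0) :
    (ω.compLinearMap (LinearMap.inl R M R)).compLinearMap (LinearMap.fst R M R) = ω := by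
  have key : ∀ x : M × R, ω.curryLeft x = ω.curryLeft (x.1, 0) := by
    intro x
    have : x = (x.1, 0) + x.2 • ((0 : M), (1 : R)) := by ext <;> simp
    conv_lhs => rw [this, map_add, map_smul, hω, smul_zero, add_zero]
  ext v
  have h2 : (((ω.curryLeft ((v 0).1, 0)).compLinearMap (LinearMap.inl R M R)).compLinearMap
      (LinearMap.fst R M R)) = ω.curryLeft ((v 0).1, 0) := by
    cases k with
    | zero =>
      ext w
      simp only [AlternatingMap.compLinearMap_apply]
      congr 1
      exact Subsingleton.elim _ _
    | succ k =>
      refine eq_pullback_of_curryLeft_eq_zero _ ?_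
      rw [AlternatingMap.curryLeft_swap, hω]
      simp
  have h3 : ω v = ω.curryLeft (v 0) (Fin.tail v) := by
    rw [AlternatingMap.curryLeft_apply_apply, Matrix.vecCons, Fin.cons_self_tail]
  rw [h3, key, ← h2]
  simp only [AlternatingMap.compLinearMap_apply, AlternatingMap.curryLeft_apply_apply]
  congr 1
  ext i
  · refine Fin.cases ?_ (fun j => ?_) i <;> simp [Fin.tail]
  · refine Fin.cases ?_ (fun j => ?_) i <;> simp [Fin.tail]

theorem compLinearMap_inl_fst {k : ℕ} (γ : M [⋀^Fin k]→ₗ[R] N) :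
    (γ.compLinearMap (LinearMap.fst R M R)).compLinearMap (LinearMap.inl R M R) = γ := by
  ext v
  simp [AlternatingMap.compLinearMap_apply]

/-- Extending the Koszul complex by one element: the lifting step of the mapping cone. -/
theorem exists_curryLeft_eq_of_lift {f : M} {s k : ℕ} (H : KoszulExactAbove R f s) (hk : s ≤ k)
    (a : R) (ω : (M × R) [⋀^Fin (k + 1)]→ₗ[R] R) (hω : ω.curryLeft (f, a) = 0)
    (γ : M [⋀^Fin (k + 1)]→ₗ[R] R)
    (hγ : γ.curryLeft f = (ω.curryLeft (0, 1)).compLinearMap (LinearMap.inl R M R)) :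
    ∃ η : (M × R) [⋀^Fin (k + 2)]→ₗ[R] R, η.curryLeft (f, a) = ω := by
  have hγ' : (γ.curryLeft f).compLinearMap (LinearMap.fst R M R) = ω.curryLeft (0, 1) := by
    rw [hγ]
    cases k with
    | zero =>
      ext w
      simp only [AlternatingMap.compLinearMap_apply]
      congr 1
      exact Subsingleton.elim _ _
    | succ k =>
      refine eq_pullback_of_curryLeft_eq_zero _ ?_
      rw [AlternatingMap.curryLeft_same]
  set ω' := ω + (wedgeSnd γ).curryLeft (f, a) with hω'
  have h1 : ω'.curryLeft (0, 1) = 0 := by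
    have h2 : (γ.compLinearMap (LinearMap.fst R M R)).curryLeft (0, 1) = 0 := by
      rw [AlternatingMap.curryLeft_compLinearMap]
      simp
    have h3 : ((wedgeSnd γ).curryLeft (f, a)).curryLeft (0, 1) = -ω.curryLeft (0, 1) := by
      rw [wedgeSnd_curryLeft, ← AlternatingMap.curryLeftLinearMap_apply, map_sub, map_smul]
      simp [h2, wedgeSnd_curryLeft_snd, hγ']
    simp [hω', h3]
  have h4 : ω'.curryLeft (f, a) = 0 := by simp [hω', hω, AlternatingMap.curryLeft_same]
  have h5 : ω'.curryLeft (f, 0) = 0 := by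
    have h6 : ((f, a) : M × R) = (f, 0) + a • (0, 1) := by simp
    rwa [h6, map_add, map_smul, h1, smul_zero, add_zero] at h4
  obtain ⟨δ, hδ⟩ := H k hk (ω'.compLinearMap (LinearMap.inl R M R)) (by
    rw [AlternatingMap.curryLeft_compLinearMap, LinearMap.inl_apply, h5]
    rfl)
  refine ⟨δ.compLinearMap (LinearMap.fst R M R) - wedgeSnd γ, ?_⟩
  rw [← AlternatingMap.curryLeftLinearMap_apply, map_sub, LinearMap.sub_apply,
    AlternatingMap.curryLeftLinearMap_apply, AlternatingMap.curryLeftLinearMap_apply,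
    AlternatingMap.curryLeft_compLinearMap, LinearMap.fst_apply, hδ,
    eq_pullback_of_curryLeft_eq_zero ω' h1, hω', add_sub_cancel_right]

theorem KoszulExactAbove.prod {f : M} {s : ℕ} (H : KoszulExactAbove R f s) (a : R) :
    KoszulExactAbove R (f, a) (s + 1) := by
  rintro (_ | k) hk ω hω
  · omega
  obtain ⟨γ, hγ⟩ := H k (by omega)
    ((ω.curryLeft (0, 1)).compLinearMap (LinearMap.inl R M R)) (by
      have h1 : (ω.curryLeft (0, 1)).curryLeft (f, a) = 0 := by
        rw [AlternatingMap.curryLeft_swap, hω]; simp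
      have h2 : ((f, a) : M × R) = (f, 0) + a • (0, 1) := by simp
      rw [h2, map_add, map_smul, AlternatingMap.curryLeft_same, smul_zero, add_zero] at h1
      rw [AlternatingMap.curryLeft_compLinearMap, LinearMap.inl_apply, h1]
      rfl)
  exact exists_curryLeft_eq_of_lift H (by omega) a ω hω γ hγ

theorem KoszulExactAbove.prod_of_regular {f : M} (H : KoszulExactAbove R f 0) (a : R)
    (ha : ∀ b : R, (∃ φ : M →ₗ[R] R, φ f = b * a) → ∃ φ : M →ₗ[R] R, φ f = b) :
    KoszulExactAbove R (f, a) 0 := by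
  rintro (_ | k) hk ω hω
  · have e : ∀ x : M × R, ω (fun _ => x) = ω.curryLeft x Fin.elim0 := by
      intro x
      rw [AlternatingMap.curryLeft_apply_apply]
      congr 1
      ext i <;> fin_cases i <;> rfl
    let L : (M × R) →ₗ[R] R := (AlternatingMap.ofSubsingleton R (M × R) R (0 : Fin 1)).symm ω
    have hL : ∀ x, L x = ω.curryLeft x Fin.elim0 := e
    obtain ⟨φ, hφ⟩ := ha (L (0, 1)) ⟨-(L ∘ₗ LinearMap.inl R M R), by
      have h0 : L (f, a) = 0 := by rw [hL, hω]; rfl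
      have h2 : ((f, a) : M × R) = (f, 0) + a • (0, 1) := by simp
      rw [h2, map_add, map_smul, smul_eq_mul] at h0
      simp only [LinearMap.neg_apply, LinearMap.comp_apply, LinearMap.inl_apply]
      linear_combination -h0⟩
    refine exists_curryLeft_eq_of_lift H hk a ω hω
      (AlternatingMap.ofSubsingleton R M R (0 : Fin 1) φ) ?_
    ext v
    simp only [AlternatingMap.curryLeft_apply_apply, AlternatingMap.ofSubsingleton_apply_apply,
      AlternatingMap.compLinearMap_apply, Matrix.cons_val_zero, hφ, hL]
    congr 1
    ext i <;> fin_cases i <;> rfl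
  · exact H.prod a (k + 1) (by omega) ω hω

theorem KoszulExactAbove.of_prod_zero {f : M} {s : ℕ}
    (H : KoszulExactAbove R ((f, 0) : M × R) (s + 1)) : KoszulExactAbove R f s := by
  intro k hk ω hω
  obtain ⟨η, hη⟩ := H (k + 1) (by omega) (wedgeSnd ω) (by
    rw [wedgeSnd_curryLeft, hω, wedgeSnd_zero]; simp)
  refine ⟨-(η.curryLeft (0, 1)).compLinearMap (LinearMap.inl R M R), ?_⟩
  have h1 : (AlternatingMap.curryLeft (-(η.curryLeft (0, 1)).compLinearMap (LinearMap.inl R M R))) f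
      = ((wedgeSnd ω).curryLeft (0, 1)).compLinearMap (LinearMap.inl R M R) := by
    rw [← hη, AlternatingMap.curryLeft_swap, ← AlternatingMap.curryLeftLinearMap_apply, map_neg,
      LinearMap.neg_apply, AlternatingMap.curryLeftLinearMap_apply,
      AlternatingMap.curryLeft_compLinearMap]
    rfl
  rw [h1, wedgeSnd_curryLeft_snd, compLinearMap_inl_fst]

theorem KoszulExactAbove.of_prod {f : M} {s : ℕ} (φ : M →ₗ[R] R)
    (H : KoszulExactAbove R (f, φ f) (s + 1)) : KoszulExactAbove R f s := by
  have := H.map_equiv (LinearEquiv.ofLinearMap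
    ((LinearMap.fst R M R).prod (LinearMap.snd R M R - φ ∘ₗ LinearMap.fst R M R))
    ((LinearMap.fst R M R).prod (LinearMap.snd R M R + φ ∘ₗ LinearMap.fst R M R))
    (by ext <;> simp) (by ext <;> simp)) (g := (f, 0)) (by simp)
  exact of_prod_zero this

/-- Splitting off the first coordinate of the second factor of `M × Rⁿ⁺¹`. -/
def prodFinSuccEquiv (R M : Type*) [CommRing R] [AddCommGroup M] [Module R M] (n : ℕ) :
    ((M × (Fin n → R)) × R) ≃ₗ[R] M × (Fin (n + 1) → R) :=
  (LinearEquiv.prodAssoc R M (Fin n → R) R).trans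
    ((LinearEquiv.refl R M).prodCongr ((LinearEquiv.prodComm R (Fin n → R) R).trans
      (Fin.consLinearEquiv R fun _ => R)))

theorem prodFinSuccEquiv_apply {n : ℕ} (f : M) (a : Fin (n + 1) → R) :
    prodFinSuccEquiv R M n ((f, Fin.tail a), a 0) = (f, a) :=
  Prod.ext rfl (Fin.cons_self_tail a)

theorem KoszulExactAbove.prod_fin {n : ℕ} {f : M} {s : ℕ} (H : KoszulExactAbove R f s)
    (a : Fin n → R) : KoszulExactAbove R (f, a) (s + n) := by
  induction n with
  | zero =>
    exact H.map_equiv (LinearEquiv.prodUnique (R := R) (M := M) (M₂ := Fin 0 → R)).symm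
      (Prod.ext rfl (Subsingleton.elim _ _))
  | succ n ih =>
    exact ((ih (Fin.tail a)).prod (a 0)).map_equiv (prodFinSuccEquiv R M n)
      (prodFinSuccEquiv_apply f a)

theorem KoszulExactAbove.of_prod_fin {n : ℕ} {f : M} {s : ℕ} (a : Fin n → R)
    (ha : ∀ i, ∃ φ : M →ₗ[R] R, φ f = a i)
    (H : KoszulExactAbove R (f, a) (s + n)) : KoszulExactAbove R f s := by
  induction n with
  | zero => exact H.map_equiv (LinearEquiv.prodUnique (R := R) (M := M) (M₂ := Fin 0 → R)) rfl
  | succ n ih =>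
    have h1 := H.map_equiv (prodFinSuccEquiv R M n).symm
      ((LinearEquiv.symm_apply_eq _).2 (prodFinSuccEquiv_apply f a).symm)
    obtain ⟨φ, hφ⟩ := ha 0
    refine ih (Fin.tail a) (fun i => ha i.succ) ?_
    refine KoszulExactAbove.of_prod (φ ∘ₗ LinearMap.fst R M (Fin n → R)) ?_
    rwa [LinearMap.comp_apply, LinearMap.fst_apply, hφ]

theorem exists_linearMap_eq_iff_mem_span_range {ι : Type*} [Fintype ι] (f : ι → R) (b : R) :
    (∃ φ : (ι → R) →ₗ[R] R, φ f = b) ↔ b ∈ Ideal.span (Set.range f) := by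
  classical
  rw [Ideal.mem_span_range_iff_exists_fun]
  constructor
  · rintro ⟨φ, rfl⟩
    refine ⟨fun i => φ (Pi.single i 1), ?_⟩
    rw [LinearMap.pi_apply_eq_sum_univ φ f]
    refine Finset.sum_congr rfl fun i _ => ?_
    rw [smul_eq_mul, mul_comm]
    refine congrArg (f i * φ ·) ?_
    funext j
    simp [Pi.single_apply, eq_comm]
  · rintro ⟨c, rfl⟩
    exact ⟨∑ i, c i • LinearMap.proj i, by simp⟩

/-- A monic polynomial in the variable `X i` is regular modulo an ideal generated by polynomials
in single other variables. -/
theorem mem_span_of_mul_aeval_X_mem {σ K : Type*} [CommRing K] {ι : Type*}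
    (j : ι → σ) (i : σ) (hij : ∀ k, j k ≠ i) (p : ι → Polynomial K) (q : Polynomial K)
    (hq : q.Monic) (b : MvPolynomial σ K)
    (hb : b * Polynomial.aeval (X i) q ∈
      Ideal.span (Set.range fun k => Polynomial.aeval (X (j k) : MvPolynomial σ K) (p k))) :
    b ∈ Ideal.span (Set.range fun k => Polynomial.aeval (X (j k) : MvPolynomial σ K) (p k)) := by
  classical
  set J := Ideal.span (Set.range fun k => Polynomial.aeval (X (j k) : MvPolynomial σ K) (p k))

  let Φ : MvPolynomial σ K →ₐ[K] Polynomial (MvPolynomial σ K ⧸ J) :=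
    aeval fun l => if l = i then Polynomial.X else Polynomial.C (Ideal.Quotient.mk J (X l))
  have hΦ : ∀ x ∈ J, Φ x = 0 := by
    intro x hx
    have : J ≤ RingHom.ker Φ := by
      refine Ideal.span_le.2 ?_
      rintro _ ⟨k, rfl⟩
      rw [SetLike.mem_coe, RingHom.mem_ker, ← Polynomial.aeval_algHom_apply]
      have h1 : Φ (X (j k)) = Polynomial.CAlgHom (R := K) (Ideal.Quotient.mkₐ K J (X (j k))) := by
        simp [Φ, hij k]
      rw [h1, Polynomial.aeval_algHom_apply, Polynomial.aeval_algHom_apply]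
      have h2 : Ideal.Quotient.mkₐ K J (Polynomial.aeval (X (j k)) (p k)) = 0 :=
        Ideal.Quotient.eq_zero_iff_mem.2 (Ideal.subset_span ⟨k, rfl⟩)
      rw [h2, map_zero]
    exact this hx
  have h3 : Φ (Polynomial.aeval (X i) q) = q.map (algebraMap K (MvPolynomial σ K ⧸ J)) := by
    rw [← Polynomial.aeval_algHom_apply]
    simp only [Φ, aeval_X, if_true]
    rw [Polynomial.aeval_X_left_eq_map]
  have h4 := hΦ _ hb
  rw [map_mul, h3] at h4
  have h5 : Φ b = 0 :=
    (hq.map _).mem_nonZeroDivisors.2 _ h4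
  have h6 : ((Polynomial.aeval (R := MvPolynomial σ K ⧸ J)
      (Ideal.Quotient.mk J (X i))).restrictScalars K).comp Φ = Ideal.Quotient.mkₐ K J := by
    ext l
    by_cases hl : l = i <;> simp [Φ, hl]
  have h7 := DFunLike.congr_fun h6 b
  rw [AlgHom.comp_apply, h5, map_zero] at h7
  exact Ideal.Quotient.eq_zero_iff_mem.1 h7.symm

theorem koszulExactAbove_aeval_X {σ K : Type*} [CommRing K] (p : σ → Polynomial K)
    (hp : ∀ i, (p i).Monic) {m : ℕ} (j : Fin m → σ) (hj : Function.Injective j) :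
    KoszulExactAbove (MvPolynomial σ K)
      (fun k => Polynomial.aeval (X (j k) : MvPolynomial σ K) (p (j k))) 0 := by
  induction m with
  | zero => exact KoszulExactAbove.of_subsingleton _
  | succ m ih =>
    have h1 := ih (Fin.tail j) (hj.comp (Fin.succ_injective m))
    refine (h1.prod_of_regular (Polynomial.aeval (X (j 0)) (p (j 0))) fun b => ?_).map_equiv
      ((LinearEquiv.prodComm _ _ _).trans
        (Fin.consLinearEquiv (MvPolynomial σ K) fun _ => MvPolynomial σ K)) ?_
    · rw [exists_linearMap_eq_iff_mem_span_range, exists_linearMap_eq_iff_mem_span_range]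
      refine mem_span_of_mul_aeval_X_mem (Fin.tail j) (j 0) (fun k hk => ?_) _ _ (hp _) b
      exact Fin.succ_ne_zero k (hj hk)
    · ext1 k
      refine Fin.cases ?_ (fun k => ?_) k <;> simp [Fin.consLinearEquiv, Fin.tail]

/-- If `f₁, …, fₘ, h` generate an ideal of finite codimension in a polynomial ring in `n`
variables, then their Koszul homology vanishes in degrees larger than `m + 1 - n`. -/
theorem koszulExactAbove_of_finite {n : ℕ} {K : Type*} [Field K]
    (f : Fin n → MvPolynomial (Fin n) K) (h : MvPolynomial (Fin n) K)
    [FiniteDimensional K (MvPolynomial (Fin n) K ⧸ Ideal.span (insert h (Set.range f)))] :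
    KoszulExactAbove (MvPolynomial (Fin n) K) (f, h) 1 := by
  have h1 : ∀ i : Fin n, ∃ p : Polynomial K, p.Monic ∧
      Polynomial.aeval (X i : MvPolynomial (Fin n) K) p ∈ Ideal.span (insert h (Set.range f)) := by
    intro i
    obtain ⟨p, hp, hp'⟩ := Algebra.IsIntegral.isIntegral (R := K)
      (Ideal.Quotient.mkₐ K (Ideal.span (insert h (Set.range f))) (X i))
    refine ⟨p, hp, ?_⟩
    rw [← Polynomial.aeval_def, Polynomial.aeval_algHom_apply] at hp'
    exact Ideal.Quotient.eq_zero_iff_mem.1 hp'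
  choose p hp hpm using h1
  have h2 := ((koszulExactAbove_aeval_X p hp id Function.injective_id).prod_fin f).prod h
  have h3 := h2.map_equiv ((LinearEquiv.prodAssoc _ _ _ _).trans (LinearEquiv.prodComm _ _ _)) rfl
  refine KoszulExactAbove.of_prod_fin (n := n) (fun k => Polynomial.aeval (X k) (p k)) ?_ ?_
  · intro i
    obtain ⟨a, z, hz, haz⟩ := Ideal.mem_span_insert.1 (hpm i)
    obtain ⟨φ, rfl⟩ := (exists_linearMap_eq_iff_mem_span_range f z).2 hz
    refine ⟨a • LinearMap.snd _ _ _ + φ ∘ₗ LinearMap.fst _ _ _, ?_⟩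
    simp [haz]
  · rw [zero_add, add_comm] at h3
    exact h3

theorem curryLeft_compLinearMap_inl {k : ℕ} {f : M} {h : R}
    (η : (M × R) [⋀^Fin (k + 1)]→ₗ[R] R) :
    (η.curryLeft (f, h)).compLinearMap (LinearMap.inl R M R) =
      (η.compLinearMap (LinearMap.inl R M R)).curryLeft f +
        h • (η.curryLeft (0, 1)).compLinearMap (LinearMap.inl R M R) := by
  have h2 : ((f, h) : M × R) = (f, 0) + h • (0, 1) := by simp
  rw [h2, map_add, map_smul, AlternatingMap.curryLeft_compLinearMap]
  rfl

/-- A cocycle modulo `h` is a coboundary modulo `h`. -/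
theorem KoszulExactAbove.exists_of_curryLeft_eq_smul {f : M} {h : R} {s k : ℕ}
    (H : KoszulExactAbove R (f, h) s) (hk : s ≤ k + 1) (ω : M [⋀^Fin (k + 2)]→ₗ[R] R)
    (ξ : M [⋀^Fin (k + 1)]→ₗ[R] R) (hω : ω.curryLeft f = h • ξ) (hξ : ξ.curryLeft f = 0) :
    ∃ (η : M [⋀^Fin (k + 3)]→ₗ[R] R) (ζ : M [⋀^Fin (k + 2)]→ₗ[R] R),
      ω = η.curryLeft f + h • ζ := by
  obtain ⟨η, hη⟩ := H (k + 1) hk (ω.compLinearMap (LinearMap.fst R M R) - wedgeSnd ξ) (by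
    rw [← AlternatingMap.curryLeftLinearMap_apply, map_sub, LinearMap.sub_apply,
      AlternatingMap.curryLeftLinearMap_apply, AlternatingMap.curryLeftLinearMap_apply,
      wedgeSnd_curryLeft, AlternatingMap.curryLeft_compLinearMap, LinearMap.fst_apply, hω, hξ,
      wedgeSnd_zero, sub_zero]
    exact sub_self _)
  refine ⟨η.compLinearMap (LinearMap.inl R M R),
    (η.curryLeft (0, 1)).compLinearMap (LinearMap.inl R M R), ?_⟩
  rw [← curryLeft_compLinearMap_inl, hη]
  change ω = (ω.compLinearMap (LinearMap.fst R M R)).compLinearMap (LinearMap.inl R M R) -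
    (wedgeSnd ξ).compLinearMap (LinearMap.inl R M R)
  rw [compLinearMap_inl_fst, wedgeSnd_compLinearMap_inl, sub_zero]

/-- A cocycle on `M` is a coboundary up to `h` times another cocycle. -/
theorem KoszulExactAbove.exists_of_curryLeft_eq_zero {f : M} {h : R} {s k : ℕ}
    (H : KoszulExactAbove R (f, h) s) (hk : s ≤ k + 1) (ω : M [⋀^Fin (k + 2)]→ₗ[R] R)
    (hω : ω.curryLeft f = 0) :
    ∃ (η : M [⋀^Fin (k + 3)]→ₗ[R] R) (ζ : M [⋀^Fin (k + 2)]→ₗ[R] R),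
      ζ.curryLeft f = 0 ∧ ω = η.curryLeft f + h • ζ := by
  obtain ⟨η, hη⟩ := H (k + 1) hk (ω.compLinearMap (LinearMap.fst R M R)) (by
    rw [AlternatingMap.curryLeft_compLinearMap, LinearMap.fst_apply, hω]
    rfl)
  refine ⟨η.compLinearMap (LinearMap.inl R M R),
    (η.curryLeft (0, 1)).compLinearMap (LinearMap.inl R M R), ?_, ?_⟩
  · have h1 := curryLeft_compLinearMap_inl (f := f) (h := h) (η.curryLeft (0, 1))
    rw [AlternatingMap.curryLeft_same] at h1
    rw [AlternatingMap.curryLeft_swap, hη, AlternatingMap.curryLeft_compLinearMap] at h1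
    simp only [LinearMap.fst_apply, map_zero] at h1
    ext v
    simpa [AlternatingMap.compLinearMap_apply] using (DFunLike.congr_fun h1 v).symm
  · rw [← curryLeft_compLinearMap_inl, hη, compLinearMap_inl_fst]

/-- The contraction of `ω` with a varying vector, evaluated at `v`. -/
def evalCurryLeft {k : ℕ} (ω : M [⋀^Fin (k + 1)]→ₗ[R] R) (v : Fin k → M) : M →ₗ[R] R where
  toFun x := ω.curryLeft x v
  map_add' x y := by rw [map_add, AlternatingMap.add_apply]
  map_smul' c x := by rw [map_smul, AlternatingMap.smul_apply]; rfl

/-- The coefficients of a Koszul cocycle lie, up to a factor that is `1` modulo `h`, in the ideal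
generated by the sequence. -/
theorem KoszulExactAbove.exists_sub_one_mem {ι : Type*} [Fintype ι] [IsNoetherianRing R]
    {f : ι → R} {h : R} {s k : ℕ} (H : KoszulExactAbove R (f, h) s) (hk : s ≤ k + 1) :
    ∃ r : R, r - 1 ∈ Ideal.span {h} ∧
      ∀ ω : (ι → R) [⋀^Fin (k + 2)]→ₗ[R] R, ω.curryLeft f = 0 →
        ∀ v, r * ω v ∈ Ideal.span (Set.range f) := by
  set Z : Ideal R := Ideal.span
    {x | ∃ ω : (ι → R) [⋀^Fin (k + 2)]→ₗ[R] R, ω.curryLeft f = 0 ∧ ∃ v, ω v = x} with hZ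
  have hle : Z ≤ Ideal.span (Set.range f) ⊔ Ideal.span {h} • Z := by
    refine Ideal.span_le.2 ?_
    rintro _ ⟨ω, hω, v, rfl⟩
    obtain ⟨η, ζ, hζ, rfl⟩ := H.exists_of_curryLeft_eq_zero hk ω hω
    refine Submodule.add_mem_sup ?_ ?_
    · rw [← exists_linearMap_eq_iff_mem_span_range]
      exact ⟨evalCurryLeft η v, rfl⟩
    · exact Submodule.smul_mem_smul (Ideal.mem_span_singleton_self h)
        (Ideal.subset_span ⟨ζ, hζ, v, rfl⟩)
  obtain ⟨r, hr, hrZ⟩ := Submodule.exists_sub_one_mem_and_smul_le_of_fg_of_le_sup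
    (IsNoetherian.noetherian Z) le_rfl hle
  exact ⟨r, hr, fun ω hω v =>
    hrZ (Submodule.smul_mem_pointwise_smul _ r Z (Ideal.subset_span ⟨ω, hω, v, rfl⟩))⟩

/-- The alternating form with prescribed antisymmetric coefficients. -/
def alternatingOfCoeff {ι : Type*} [Fintype ι] {k : ℕ} (c : (Fin k → ι) → R)
    (hc : ∀ v i j, i ≠ j → c (v ∘ Equiv.swap i j) = -c v)
    (hc' : ∀ v i j, i ≠ j → v i = v j → c v = 0) : (ι → R) [⋀^Fin k]→ₗ[R] R where
  toMultilinearMap := ∑ v : Fin k → ι,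
    c v • (MultilinearMap.mkPiAlgebra R (Fin k) R).compLinearMap fun i => LinearMap.proj (v i)
  map_eq_zero_of_eq' := by
    classical
    intro m i j hm hij
    simp only [MultilinearMap.toFun_eq_coe, _root_.sum_apply, _root_.smul_apply,
      MultilinearMap.compLinearMap_apply, MultilinearMap.mkPiAlgebra_apply, LinearMap.proj_apply,
      smul_eq_mul]
    refine Finset.sum_involution (fun v _ => v ∘ Equiv.swap i j) ?_ ?_ ?_ ?_
    · intro v _
      have h1 : ∏ l, m l ((v ∘ Equiv.swap i j) l) = ∏ l, m l (v l) := by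
        rw [← Equiv.prod_comp (Equiv.swap i j)]
        refine Finset.prod_congr rfl fun l _ => ?_
        have h2 : m (Equiv.swap i j l) = m l := by
          by_cases hi : l = i
          · subst hi; simp [hm]
          by_cases hj : l = j
          · subst hj; simp [hm]
          rw [Equiv.swap_apply_of_ne_of_ne hi hj]
        simp [h2]
      rw [h1, hc v i j hij]
      ring
    · intro v _ hv he
      refine hv ?_
      rw [hc' v i j hij, zero_mul]
      have := congrFun he i
      simpa using this.symm
    · intro v _
      exact Finset.mem_univ _
    · intro v _
      ext l
      simp

theorem alternatingOfCoeff_apply {ι : Type*} [Fintype ι] {k : ℕ} (c : (Fin k → ι) → R)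
    (hc : ∀ v i j, i ≠ j → c (v ∘ Equiv.swap i j) = -c v)
    (hc' : ∀ v i j, i ≠ j → v i = v j → c v = 0) (m : Fin k → ι → R) :
    alternatingOfCoeff c hc hc' m = ∑ v : Fin k → ι, c v * ∏ i, m i (v i) := by
  rw [← AlternatingMap.coe_multilinearMap, alternatingOfCoeff]
  simp

theorem alternatingOfCoeff_single {ι : Type*} [Fintype ι] [DecidableEq ι] {k : ℕ}
    (c : (Fin k → ι) → R) (hc : ∀ v i j, i ≠ j → c (v ∘ Equiv.swap i j) = -c v)
    (hc' : ∀ v i j, i ≠ j → v i = v j → c v = 0) (w : Fin k → ι) :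
    alternatingOfCoeff c hc hc' (fun i => Pi.single (w i) 1) = c w := by
  rw [alternatingOfCoeff_apply]
  rw [Finset.sum_eq_single w]
  · simp
  · intro v _ hv
    obtain ⟨i, hi⟩ := Function.ne_iff.1 hv
    rw [Finset.prod_eq_zero (Finset.mem_univ i), mul_zero]
    simp [hi]
  · simp

theorem curryLeft_single {ι : Type*} [Fintype ι] [DecidableEq ι] {k : ℕ}
    (ω : (ι → R) [⋀^Fin (k + 1)]→ₗ[R] R) (f : ι → R) (w : Fin k → ι) :
    ω.curryLeft f (fun i => Pi.single (w i) 1) =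
      ∑ l, f l * ω (fun i => Pi.single ((Matrix.vecCons l w : Fin (k + 1) → ι) i) 1) := by
  have h1 : f = ∑ l, f l • (Pi.single l 1 : ι → R) := by
    ext i
    simp [Pi.single_apply]
  change evalCurryLeft ω (fun i => Pi.single (w i) 1) f = _
  conv_lhs => rw [h1, map_sum]
  refine Finset.sum_congr rfl fun l _ => ?_
  rw [map_smul, smul_eq_mul]
  refine congrArg (f l * ω ·) ?_
  ext i
  refine Fin.cases ?_ (fun i => ?_) i <;> simp

theorem ext_single {ι : Type*} [Finite ι] [DecidableEq ι] {k : ℕ}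
    {ω η : (ι → R) [⋀^Fin k]→ₗ[R] N}
    (H : ∀ w : Fin k → ι, ω (fun i => Pi.single (w i) 1) = η (fun i => Pi.single (w i) 1)) :
    ω = η := by
  refine Module.Basis.ext_alternating (Pi.basisFun R ι) fun v _ => ?_
  simpa using H v

/-- An antisymmetric matrix killed by `f` modulo `h` is, modulo `h`, the contraction with `f` of an
alternating array. -/
theorem KoszulExactAbove.exists_alternating_of_matrix {ι : Type*} [Fintype ι] [IsDomain R]
    {f : ι → R} {h : R} (H : KoszulExactAbove R (f, h) 1) (hh : h ≠ 0) (π : ι → ι → R)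
    (hπ : ∀ i j, π i j = -π j i) (hπ' : ∀ i, π i i = 0)
    (hf : ∀ j, ∑ i, f i * π i j ∈ Ideal.span {h}) :
    ∃ p : ι → ι → ι → R,
      (∀ (σ : Equiv.Perm (Fin 3)) (v : Fin 3 → ι),
        p (v (σ 0)) (v (σ 1)) (v (σ 2)) =
          (Equiv.Perm.sign σ : ℤ) • p (v 0) (v 1) (v 2)) ∧
      ∀ i j, π i j - ∑ k, p i j k * f k ∈ Ideal.span {h} := by
  classical
  simp_rw [Ideal.mem_span_singleton] at hf
  choose x hx using hf
  let ω : (ι → R) [⋀^Fin 2]→ₗ[R] R := alternatingOfCoeff (fun v => π (v 0) (v 1))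
    (by
      intro v i j hij
      fin_cases i <;> fin_cases j <;> first | exact absurd rfl hij | simpa using hπ _ _)
    (by
      intro v i j hij hv
      fin_cases i <;> fin_cases j <;> first
        | exact absurd rfl hij
        | (simp only [Fin.zero_eta, Fin.mk_one] at hv; simp [hv, hπ']))
  have hω : ∀ w : Fin 2 → ι, ω (fun i => Pi.single (w i) 1) = π (w 0) (w 1) :=
    fun w => alternatingOfCoeff_single _ _ _ w
  let ξ : (ι → R) [⋀^Fin 1]→ₗ[R] R :=
    AlternatingMap.ofSubsingleton R (ι → R) R (0 : Fin 1) (∑ j, x j • LinearMap.proj j)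
  have h1 : ω.curryLeft f = h • ξ := by
    refine ext_single fun w => ?_
    rw [curryLeft_single]
    simp only [hω]
    simp [ξ, hx, Pi.single_apply]
  have h2 : ξ.curryLeft f = 0 := by
    have h3 : h • ξ.curryLeft f = 0 := by
      rw [← LinearMap.smul_apply, ← AlternatingMap.curryLeft_smul, ← h1,
        AlternatingMap.curryLeft_same]
    ext v
    have h4 := DFunLike.congr_fun h3 v
    rw [AlternatingMap.smul_apply, smul_eq_mul] at h4
    exact (mul_eq_zero.1 h4).resolve_left hh
  obtain ⟨η, ζ, hη⟩ := H.exists_of_curryLeft_eq_smul (k := 0) le_rfl ω ξ h1 h2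
  have hperm : ∀ (σ : Equiv.Perm (Fin 3)) (v : Fin 3 → ι),
      η (fun l => Pi.single (![v (σ 0), v (σ 1), v (σ 2)] l) 1) =
        (Equiv.Perm.sign σ : ℤ) • η (fun l => Pi.single (![v 0, v 1, v 2] l) 1) := by
    intro σ v
    have h5 := η.map_perm (fun l => Pi.single (v l) 1) σ
    have h6 : ![v (σ 0), v (σ 1), v (σ 2)] = v ∘ σ := by
      ext l; fin_cases l <;> rfl
    have h7 : ![v 0, v 1, v 2] = v := by
      ext l; fin_cases l <;> rfl
    rw [h6, h7]
    exact h5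
  refine ⟨fun i j k => η (fun l => Pi.single (![i, j, k] l) 1), hperm, fun i j => ?_⟩
  have h8 : ∀ k, η (fun l => Pi.single (![i, j, k] l) 1) =
      η (fun l => Pi.single (![k, i, j] l) 1) := by
    intro k
    have h9 := hperm (finRotate 3) ![k, i, j]
    simpa [sign_finRotate] using h9
  have h10 := DFunLike.congr_fun hη (fun l => Pi.single (![i, j] l) 1)
  rw [hω, AlternatingMap.add_apply, curryLeft_single, AlternatingMap.smul_apply] at h10
  rw [Ideal.mem_span_singleton]
  refine ⟨ζ (fun l => Pi.single (![i, j] l) 1), ?_⟩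
  rw [sub_eq_iff_eq_add', ← smul_eq_mul]
  refine h10.trans (congrArg (· + _) (Finset.sum_congr rfl fun k _ => ?_))
  rw [mul_comm, ← h8]

end Koszul

section Bivector

variable {K B ι : Type*} [CommRing K] [CommRing B] [Algebra K B] [Fintype ι]

/-- The biderivation with coefficients `π` in terms of the derivations `D`. -/
def bivectorBracket (D : ι → Derivation K B B) (π : ι → ι → B) (F G : B) : B :=
  ∑ i, ∑ j, π i j * D i F * D j G

/-- The Jacobiator of `bivectorBracket D π`. -/
def jacobiator (D : ι → Derivation K B B) (π : ι → ι → B) (F G H : B) : B :=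
  bivectorBracket D π (bivectorBracket D π F G) H +
    bivectorBracket D π (bivectorBracket D π G H) F +
    bivectorBracket D π (bivectorBracket D π H F) G

variable (D : ι → Derivation K B B) (π : ι → ι → B)

theorem derivation_sum_apply {A M κ : Type*} [CommRing A] [Algebra K A] [AddCommGroup M]
    [Module A M] [Module K M] (s : Finset κ) (E : κ → Derivation K A M) (x : A) :
    (∑ i ∈ s, E i) x = ∑ i ∈ s, E i x := by
  rw [← Derivation.coeFnAddMonoidHom_apply, map_sum, Finset.sum_apply]
  rfl

/-- The Hamiltonian derivation of `F`. -/
def hamiltonian (F : B) : Derivation K B B :=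
  ∑ i, ∑ j, (π i j * D i F) • D j

theorem hamiltonian_apply (F G : B) : hamiltonian D π F G = bivectorBracket D π F G := by
  simp [hamiltonian, bivectorBracket, derivation_sum_apply]

theorem bivectorBracket_antisymm (hπ : ∀ i j, π i j = -π j i) (F G : B) :
    bivectorBracket D π F G = -bivectorBracket D π G F := by
  unfold bivectorBracket
  rw [Finset.sum_comm, ← Finset.sum_neg_distrib]
  refine Finset.sum_congr rfl fun i _ => ?_
  rw [← Finset.sum_neg_distrib]
  refine Finset.sum_congr rfl fun j _ => ?_
  rw [hπ j i]
  ring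

theorem bivectorBracket_neg_left (F G : B) :
    bivectorBracket D π (-F) G = -bivectorBracket D π F G := by
  simp [bivectorBracket]

theorem jacobiator_cyclic (F G H : B) : jacobiator D π F G H = jacobiator D π G H F := by
  unfold jacobiator
  ring

theorem jacobiator_swap (hπ : ∀ i j, π i j = -π j i) (F G H : B) :
    jacobiator D π F G H = -jacobiator D π G F H := by
  unfold jacobiator
  rw [bivectorBracket_antisymm D π hπ F G, bivectorBracket_antisymm D π hπ G H,
    bivectorBracket_antisymm D π hπ H F]
  simp only [bivectorBracket_neg_left]
  ring

theorem jacobiator_eq_derivation (hπ : ∀ i j, π i j = -π j i) (F G H : B) :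
    jacobiator D π F G H = (hamiltonian D π (bivectorBracket D π F G) -
      ⁅hamiltonian D π F, hamiltonian D π G⁆) H := by
  simp only [Derivation.sub_apply, Derivation.commutator_apply, hamiltonian_apply]
  unfold jacobiator
  rw [bivectorBracket_antisymm D π hπ F (bivectorBracket D π G H),
    bivectorBracket_antisymm D π hπ G (bivectorBracket D π F H),
    bivectorBracket_antisymm D π hπ F H]
  simp only [bivectorBracket_neg_left]
  ring

theorem jacobiator_expand_right (hπ : ∀ i j, π i j = -π j i) (x : ι → B)
    (hx : ∀ (E : Derivation K B B) (F : B), E F = ∑ i, E (x i) * D i F) (F G H : B) :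
    jacobiator D π F G H = ∑ k, jacobiator D π F G (x k) * D k H := by
  simp only [jacobiator_eq_derivation D π hπ F G]
  exact hx _ _

theorem jacobiator_expand (hπ : ∀ i j, π i j = -π j i) (x : ι → B)
    (hx : ∀ (E : Derivation K B B) (F : B), E F = ∑ i, E (x i) * D i F) (F G H : B) :
    jacobiator D π F G H =
      ∑ i, ∑ j, ∑ k, jacobiator D π (x i) (x j) (x k) * D i F * D j G * D k H := by
  rw [jacobiator_cyclic, jacobiator_expand_right D π hπ x hx]
  refine Finset.sum_congr rfl fun i _ => ?_
  rw [← jacobiator_cyclic D π (x i) G H, ← jacobiator_cyclic D π H (x i) G,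
    jacobiator_expand_right D π hπ x hx H (x i) G, Finset.sum_mul]
  refine Finset.sum_congr rfl fun j _ => ?_
  rw [jacobiator_cyclic, jacobiator_expand_right D π hπ x hx, Finset.sum_mul, Finset.sum_mul]
  refine Finset.sum_congr rfl fun k _ => ?_
  ring

theorem map_bivectorBracket {B' : Type*} [CommRing B'] [Algebra K B'] (φ : B →+* B')
    (D' : ι → Derivation K B' B') (hD : ∀ i F, D' i (φ F) = φ (D i F)) (F G : B) :
    bivectorBracket D' (fun i j => φ (π i j)) (φ F) (φ G) = φ (bivectorBracket D π F G) := by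
  simp [bivectorBracket, hD, map_sum]

theorem map_jacobiator {B' : Type*} [CommRing B'] [Algebra K B'] (φ : B →+* B')
    (D' : ι → Derivation K B' B') (hD : ∀ i F, D' i (φ F) = φ (D i F)) (F G H : B) :
    jacobiator D' (fun i j => φ (π i j)) (φ F) (φ G) (φ H) = φ (jacobiator D π F G H) := by
  simp only [jacobiator, map_bivectorBracket D π φ D' hD, map_add]

theorem MvPolynomial.derivation_eq_sum_pderiv {M : Type*} [AddCommGroup M] [Module K M]
    [Module (MvPolynomial ι K) M] [IsScalarTower K (MvPolynomial ι K) M]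
    (E : Derivation K (MvPolynomial ι K) M) (F : MvPolynomial ι K) :
    E F = ∑ i, pderiv i F • E (X i) := by
  classical
  have h1 : E = ∑ i, (LinearMap.toSpanSingleton (MvPolynomial ι K) M (E (X i))).compDer
      (pderiv i) := by
    refine MvPolynomial.derivation_ext fun j => ?_
    simp [derivation_sum_apply, pderiv_X, Pi.single_apply]
  conv_lhs => rw [h1]
  simp [derivation_sum_apply]

theorem IsLocalization.derivation_eq_zero {A : Type*} [CommRing A] [Algebra A B]
    (S : Submonoid A) [IsLocalization S B] (E : Derivation K B B)
    (hE : ∀ a : A, E (algebraMap A B a) = 0) : E = 0 := by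
  ext x
  obtain ⟨⟨a, s⟩, hx⟩ := IsLocalization.surj S x
  have h1 := congrArg E hx
  rw [Derivation.leibniz, hE, hE, smul_zero, zero_add, smul_eq_mul] at h1
  exact (IsLocalization.map_units B s).mul_right_eq_zero.1 h1

end Bivector

section AlternatingArray

theorem alternating_swap_left {ι R : Type*} [Ring R] {p : ι → ι → ι → R}
    (hp : ∀ (σ : Equiv.Perm (Fin 3)) (v : Fin 3 → ι),
      p (v (σ 0)) (v (σ 1)) (v (σ 2)) = (Equiv.Perm.sign σ : ℤ) • p (v 0) (v 1) (v 2))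
    (i j k : ι) : p i j k = -p j i k := by
  simpa [Equiv.swap_apply_of_ne_of_ne] using hp (Equiv.swap 0 1) ![j, i, k]

theorem alternating_swap_right {ι R : Type*} [Ring R] {p : ι → ι → ι → R}
    (hp : ∀ (σ : Equiv.Perm (Fin 3)) (v : Fin 3 → ι),
      p (v (σ 0)) (v (σ 1)) (v (σ 2)) = (Equiv.Perm.sign σ : ℤ) • p (v 0) (v 1) (v 2))
    (i j k : ι) : p i j k = -p i k j := by
  simpa [Equiv.swap_apply_of_ne_of_ne] using hp (Equiv.swap 1 2) ![i, k, j]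

variable {ι R : Type*} [Fintype ι] [CommRing R] [IsDomain R] [CharZero R]

theorem sum_mul_mul_eq_zero_of_antisymm {a : ι → ι → R} (ha : ∀ i j, a i j = -a j i)
    (f : ι → R) : ∑ i, ∑ j, a i j * f i * f j = 0 := by
  refine self_eq_neg.1 ?_
  conv_lhs => rw [Finset.sum_comm]
  rw [← Finset.sum_neg_distrib]
  refine Finset.sum_congr rfl fun i _ => ?_
  rw [← Finset.sum_neg_distrib]
  refine Finset.sum_congr rfl fun j _ => ?_
  rw [ha j i]
  ring

/-- An alternating array killed by contraction with `f` has entries in the ideal generated by `f`,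
up to a factor that is `1` modulo `h`. -/
theorem KoszulExactAbove.exists_mul_eq_sum [IsNoetherianRing R] {f : ι → R} {h : R}
    (H : KoszulExactAbove R (f, h) 1) {S : ι → ι → ι → R}
    (hS : ∀ i j k, S i j k = -S j i k) (hS' : ∀ i j k, S i j k = S j k i)
    (hf : ∀ i j, ∑ k, S i j k * f k = 0) :
    ∃ (r : R) (c : ι → ι → ι → ι → R), r - 1 ∈ Ideal.span {h} ∧
      ∀ i j k, r * S i j k = ∑ l, c i j k l * f l := by
  classical
  obtain ⟨r, hr, hrS⟩ := H.exists_sub_one_mem (k := 1) (by norm_num)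
  have hS0 : ∀ i k, S i i k = 0 := fun i k => self_eq_neg.1 (hS i i k)
  let ω : (ι → R) [⋀^Fin 3]→ₗ[R] R := alternatingOfCoeff (fun v => S (v 0) (v 1) (v 2))
    (by
      intro v i j hij
      have h1 := hS (v 1) (v 0) (v 2)
      have h2 := hS (v 2) (v 1) (v 0)
      have h3 := hS (v 0) (v 2) (v 1)
      rw [hS' (v 1) (v 2) (v 0), hS' (v 2) (v 0) (v 1)] at *
      fin_cases i <;> fin_cases j <;> first
        | exact absurd rfl hij
        | (simp [Equiv.swap_apply_of_ne_of_ne]; grind))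
    (by
      intro v i j hij hv
      fin_cases i <;> fin_cases j <;> first
        | exact absurd rfl hij
        | (simp at hv ⊢; grind))
  have hω : ∀ w : Fin 3 → ι, ω (fun i => Pi.single (w i) 1) = S (w 0) (w 1) (w 2) :=
    fun w => alternatingOfCoeff_single _ _ _ w
  have h1 : ω.curryLeft f = 0 := by
    refine ext_single fun w => ?_
    rw [curryLeft_single, AlternatingMap.zero_apply, ← hf (w 0) (w 1)]
    refine Finset.sum_congr rfl fun l _ => ?_
    rw [hω, mul_comm]
    exact congrArg (· * f l) (hS' _ _ _)
  have h2 : ∀ i j k, ∃ c : ι → R, ∑ l, c l * f l = r * S i j k := fun i j k =>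
    Ideal.mem_span_range_iff_exists_fun.1
      (hω ![i, j, k] ▸ hrS ω h1 fun l => Pi.single (![i, j, k] l) 1)
  choose c hc using h2
  exact ⟨r, c, hr, fun i j k => (hc i j k).symm⟩

end AlternatingArray

theorem exists_jacobiator_eq {ι K : Type*} [Fintype ι] [Field K] [CharZero K]
    {h : MvPolynomial ι K} (hh : h ≠ 0)
    (H : KoszulExactAbove (MvPolynomial ι K) (fun i => pderiv i h, h) 1)
    {p : ι → ι → ι → MvPolynomial ι K}
    (hp : ∀ i j k, p i j k = -p j i k) (hp' : ∀ i j k, p i j k = -p i k j)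
    (hJ : ∀ F G E, jacobiator pderiv (fun i j => ∑ k, p i j k * pderiv k h) F G E ∈
      Ideal.span {h}) :
    ∃ (r : MvPolynomial ι K) (c : ι → ι → ι → ι → MvPolynomial ι K), r - 1 ∈ Ideal.span {h} ∧
      ∀ i j k, r * jacobiator pderiv (fun i j => ∑ k, p i j k * pderiv k h) (X i) (X j) (X k) =
        h * ∑ l, c i j k l * pderiv l h := by
  set π : ι → ι → MvPolynomial ι K := fun i j => ∑ k, p i j k * pderiv k h with hπdef
  have hπ : ∀ i j, π i j = -π j i := fun i j => by
    simp only [hπdef]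
    rw [← Finset.sum_neg_distrib]
    exact Finset.sum_congr rfl fun k _ => by rw [hp, neg_mul]
  simp only [Ideal.mem_span_singleton] at hJ
  choose S hS using fun i j k => hJ (X i) (X j) (X k)
  have hcas : ∀ F, bivectorBracket pderiv π F h = 0 := fun F => by
    refine Finset.sum_eq_zero fun i _ => ?_
    have h1 := sum_mul_mul_eq_zero_of_antisymm (hp' i) fun k => pderiv k h
    have h2 : ∑ j, π i j * pderiv i F * pderiv j h =
        pderiv i F * ∑ j, ∑ k, p i j k * pderiv j h * pderiv k h := by
      rw [Finset.mul_sum]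
      refine Finset.sum_congr rfl fun j _ => ?_
      simp only [hπdef, Finset.sum_mul, Finset.mul_sum]
      exact Finset.sum_congr rfl fun k _ => by ring
    rw [h2, h1, mul_zero]
  have hcas' : ∀ F, bivectorBracket pderiv π h F = 0 := fun F => by
    rw [bivectorBracket_antisymm pderiv π hπ, hcas, neg_zero]
  have hz : ∀ F, bivectorBracket pderiv π 0 F = 0 := fun F => by
    simp [bivectorBracket]
  have hx : ∀ (E : Derivation K (MvPolynomial ι K) (MvPolynomial ι K)) (F : MvPolynomial ι K),
      E F = ∑ i, E (X i) * pderiv i F := fun E F => by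
    rw [MvPolynomial.derivation_eq_sum_pderiv]
    exact Finset.sum_congr rfl fun i _ => mul_comm _ _
  obtain ⟨r, c, hr, hc⟩ := H.exists_mul_eq_sum (S := S)
    (fun i j k => mul_left_cancel₀ hh (by
      rw [mul_neg, ← hS, ← hS, jacobiator_swap pderiv π hπ]))
    (fun i j k => mul_left_cancel₀ hh (by rw [← hS, ← hS, jacobiator_cyclic]))
    (fun i j => mul_left_cancel₀ hh (by
      rw [Finset.mul_sum, mul_zero]
      simp only [← mul_assoc, ← hS]
      rw [← jacobiator_expand_right pderiv π hπ X hx (X i) (X j) h]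
      simp [jacobiator, hcas, hcas', hz]))
  refine ⟨r, c, hr, fun i j k => ?_⟩
  rw [hS, ← hc]
  ring

theorem derivation_eq_sum_of_isLocalization {ι K B : Type*} [Fintype ι] [CommRing K] [CommRing B]
    [Algebra K B] [Algebra (MvPolynomial ι K) B] [IsScalarTower K (MvPolynomial ι K) B]
    (S : Submonoid (MvPolynomial ι K)) [IsLocalization S B] {D : ι → Derivation K B B}
    (hD : ∀ i (F : MvPolynomial ι K), D i (algebraMap _ B F) = algebraMap _ B (pderiv i F))
    (E : Derivation K B B) (F : B) :
    E F = ∑ i, E (algebraMap (MvPolynomial ι K) B (X i)) * D i F := by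
  have h1 := IsLocalization.derivation_eq_zero S
    (E - ∑ i, E (algebraMap (MvPolynomial ι K) B (X i)) • D i) fun a => by
      have h2 := MvPolynomial.derivation_eq_sum_pderiv (E.compAlgebraMap (MvPolynomial ι K)) a
      have h3 : ∀ b, E.compAlgebraMap (MvPolynomial ι K) b = E (algebraMap _ B b) := fun _ => rfl
      rw [Derivation.sub_apply, derivation_sum_apply, ← h3, h2, sub_eq_zero]
      refine Finset.sum_congr rfl fun i _ => ?_
      rw [Derivation.smul_apply, hD, Algebra.smul_def, smul_eq_mul, mul_comm, h3]
  have h4 := DFunLike.congr_fun h1 F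
  rw [Derivation.sub_apply, derivation_sum_apply] at h4
  exact sub_eq_zero.1 h4

theorem jacobiator_eq_of_isLocalization {ι K B : Type*} [Fintype ι] [CommRing K] [CommRing B]
    [Algebra K B] [Algebra (MvPolynomial ι K) B] [IsScalarTower K (MvPolynomial ι K) B]
    (S : Submonoid (MvPolynomial ι K)) [IsLocalization S B] {D : ι → Derivation K B B}
    (hD : ∀ i (F : MvPolynomial ι K), D i (algebraMap _ B F) = algebraMap _ B (pderiv i F))
    {π : ι → ι → MvPolynomial ι K} (hπ : ∀ i j, π i j = -π j i) {r h : MvPolynomial ι K} {u : B}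
    (hu : u * algebraMap _ B r = 1) {c : ι → ι → ι → ι → MvPolynomial ι K}
    (hc : ∀ i j k, r * jacobiator pderiv π (X i) (X j) (X k) = h * ∑ l, c i j k l * pderiv l h)
    (F₁ F₂ F₃ : B) :
    jacobiator D (fun i j => algebraMap _ B (π i j)) F₁ F₂ F₃ =
      algebraMap _ B h * ∑ i, ∑ j, ∑ k, ∑ l, u * algebraMap _ B (c i j k l) *
        D i F₁ * D j F₂ * D k F₃ * D l (algebraMap _ B h) := by
  rw [jacobiator_expand D _ (fun i j => by rw [hπ, map_neg]) _
    (derivation_eq_sum_of_isLocalization S hD) F₁ F₂ F₃, Finset.mul_sum]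
  refine Finset.sum_congr rfl fun i _ => ?_
  rw [Finset.mul_sum]
  refine Finset.sum_congr rfl fun j _ => ?_
  rw [Finset.mul_sum]
  refine Finset.sum_congr rfl fun k _ => ?_
  rw [map_jacobiator pderiv π _ D hD]
  have h1 := congrArg (fun x => u * algebraMap (MvPolynomial ι K) B x) (hc i j k)
  simp only [map_mul, ← mul_assoc, hu, one_mul] at h1
  rw [h1, map_sum]
  simp only [Finset.mul_sum, Finset.sum_mul]
  refine Finset.sum_congr rfl fun l _ => ?_
  rw [map_mul, hD]
  ring

section Poisson

theorem ne_zero_of_finite_quotient {n : ℕ} [NeZero n] {K : Type*} [Field K]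
    {h : MvPolynomial (Fin n) K}
    (H : FiniteDimensional K (MvPolynomial (Fin n) K ⧸
      Ideal.span (insert h (Set.range fun i => pderiv i h)))) : h ≠ 0 := by
  rintro rfl
  have h1 : Ideal.span (insert (0 : MvPolynomial (Fin n) K)
      (Set.range fun i : Fin n => pderiv i (0 : MvPolynomial (Fin n) K))) = ⊥ := by
    rw [Ideal.span_eq_bot]
    rintro x (rfl | ⟨i, rfl⟩) <;> simp
  rw [h1] at H
  have h2 : Module.Finite K (MvPolynomial (Fin n) K) :=
    Module.Finite.equiv (AlgEquiv.quotientBot K (MvPolynomial (Fin n) K)).toLinearEquiv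
  exact MvPolynomial.transcendental_X K (0 : Fin n)
    ((Algebra.IsIntegral.of_finite K (MvPolynomial (Fin n) K)).isIntegral (X 0)).isAlgebraic

namespace IsPoissonBracket

variable {R : Type*} [CommRing R] [Algebra ℂ R] {br : R → R → R}

theorem antisymm (hbr : IsPoissonBracket br) (f g : R) : br f g = -br g f :=
  hbr.2.2.1 f g

theorem cyclic_sum_left (hbr : IsPoissonBracket br) (f g k : R) :
    br (br f g) k + br (br g k) f + br (br k f) g = 0 := by
  have h1 := hbr.2.2.2.2.2 f g k
  rw [hbr.antisymm f (br g k), hbr.antisymm g (br k f), hbr.antisymm k (br f g)] at h1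
  linear_combination -h1

theorem zero_left (hbr : IsPoissonBracket br) (g : R) : br 0 g = 0 := by
  simpa using hbr.1 1 0 0 g

/-- The Hamiltonian derivation `br f` pulled back along `A → R`. -/
def toDerivation (hbr : IsPoissonBracket br) (A : Type*) [CommRing A] [Algebra ℂ A] [Algebra A R]
    [IsScalarTower ℂ A R] (f : R) : Derivation ℂ A R :=
  Derivation.compAlgebraMap A (Derivation.mk'
    { toFun := br f
      map_add' := fun g k => by simpa using hbr.2.1 1 f g k
      map_smul' := fun c g => by
        have h0 : br f 0 = 0 := by simpa using hbr.2.1 1 f 0 0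
        simpa [h0] using hbr.2.1 c f g 0 }
    fun g k => by
      simp only [LinearMap.coe_mk, AddHom.coe_mk, smul_eq_mul, hbr.2.2.2.1 f g k]
      ring)

theorem toDerivation_apply (hbr : IsPoissonBracket br) {A : Type*} [CommRing A] [Algebra ℂ A]
    [Algebra A R] [IsScalarTower ℂ A R] (f : R) (a : A) :
    hbr.toDerivation A f a = br f (algebraMap A R a) :=
  rfl

theorem apply_algebraMap_right {ι : Type*} [Fintype ι] [Algebra (MvPolynomial ι ℂ) R]
    [IsScalarTower ℂ (MvPolynomial ι ℂ) R] (hbr : IsPoissonBracket br) (f : R)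
    (G : MvPolynomial ι ℂ) :
    br f (algebraMap _ R G) =
      ∑ j, algebraMap _ R (pderiv j G) * br f (algebraMap (MvPolynomial ι ℂ) R (X j)) := by
  simp only [← toDerivation_apply hbr]
  rw [MvPolynomial.derivation_eq_sum_pderiv]
  simp only [Algebra.smul_def]

/-- A Poisson bracket is determined by its values on the generators. -/
theorem eq_bivectorBracket {ι : Type*} [Fintype ι] [Algebra (MvPolynomial ι ℂ) R]
    [IsScalarTower ℂ (MvPolynomial ι ℂ) R] (hbr : IsPoissonBracket br)
    {π : ι → ι → MvPolynomial ι ℂ}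
    (hπ : ∀ i j, algebraMap _ R (π i j) =
      br (algebraMap (MvPolynomial ι ℂ) R (X i)) (algebraMap (MvPolynomial ι ℂ) R (X j)))
    (F G : MvPolynomial ι ℂ) :
    br (algebraMap _ R F) (algebraMap _ R G) = algebraMap _ R (bivectorBracket pderiv π F G) := by
  rw [bivectorBracket, Finset.sum_comm, apply_algebraMap_right hbr, map_sum]
  refine Finset.sum_congr rfl fun j _ => ?_
  rw [hbr.antisymm, apply_algebraMap_right hbr, map_sum, ← Finset.sum_neg_distrib, Finset.mul_sum]
  refine Finset.sum_congr rfl fun i _ => ?_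
  rw [map_mul, map_mul, hπ, hbr.antisymm (algebraMap _ R (X i))]
  ring

theorem exists_antisymm_lift {ι : Type*} [Fintype ι] [Algebra (MvPolynomial ι ℂ) R]
    (hbr : IsPoissonBracket br)
    (hs : Function.Surjective (algebraMap (MvPolynomial ι ℂ) R)) :
    ∃ π : ι → ι → MvPolynomial ι ℂ, (∀ i j, π i j = -π j i) ∧ (∀ i, π i i = 0) ∧
      ∀ i j, algebraMap _ R (π i j) =
        br (algebraMap (MvPolynomial ι ℂ) R (X i)) (algebraMap (MvPolynomial ι ℂ) R (X j)) := by
  choose s hs using hs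
  let L : ι → ι → MvPolynomial ι ℂ := fun i j =>
    s (br (algebraMap (MvPolynomial ι ℂ) R (X i)) (algebraMap (MvPolynomial ι ℂ) R (X j)))
  refine ⟨fun i j => C (1 / 2) * (L i j - L j i), fun i j => by ring, fun i => by simp,
    fun i j => ?_⟩
  have h1 : C (1 / 2 : ℂ) + C (1 / 2) = (1 : MvPolynomial ι ℂ) := by
    rw [← C_add]; norm_num
  have h2 := congrArg (algebraMap (MvPolynomial ι ℂ) R) h1
  rw [map_add, map_one] at h2
  rw [map_mul, map_sub, hs, hs, hbr.antisymm (algebraMap _ R (X j))]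
  linear_combination
    br (algebraMap (MvPolynomial ι ℂ) R (X i)) (algebraMap (MvPolynomial ι ℂ) R (X j)) * h2

end IsPoissonBracket

end Poisson

theorem poisson_bracket_hypersurface_with_correction
    (n : ℕ) (hn : 3 ≤ n) (h : MvPolynomial (Fin n) ℂ)
    -- the hypersurface `h = 0` has isolated singularities
    (hsing : FiniteDimensional ℂ
      ((MvPolynomial (Fin n) ℂ) ⧸
        Ideal.span (insert h (Set.range fun i => pderiv i h))))
    (br : (MvPolynomial (Fin n) ℂ ⧸ Ideal.span {h}) →
      (MvPolynomial (Fin n) ℂ ⧸ Ideal.span {h}) →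
      (MvPolynomial (Fin n) ℂ ⧸ Ideal.span {h}))
    (hbr : IsPoissonBracket br)
    (P : Ideal (MvPolynomial (Fin n) ℂ ⧸ Ideal.span {h})) (hP : P.IsPrime)
    -- `D i` is the unique extension of the partial derivative `∂ᵢ` to the
    -- localization `A_{P'}` of `A` at the preimage `P'` of `P`
    (D : Fin n → Derivation ℂ
      (Localization.AtPrime (P.comap (Ideal.Quotient.mk (Ideal.span {h}))))
      (Localization.AtPrime (P.comap (Ideal.Quotient.mk (Ideal.span {h})))))
    (hD : ∀ (i : Fin n) (F : MvPolynomial (Fin n) ℂ),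
      D i (algebraMap _ _ F) = algebraMap _ _ (pderiv i F)) :
    ∃ (p : Fin n → Fin n → Fin n →
        Localization.AtPrime (P.comap (Ideal.Quotient.mk (Ideal.span {h}))))
      (q : Fin n → Fin n → Fin n → Fin n →
        Localization.AtPrime (P.comap (Ideal.Quotient.mk (Ideal.span {h})))),
      -- `p` is alternating under permutations of its three indices
      (∀ (σ : Equiv.Perm (Fin 3)) (v : Fin 3 → Fin n),
        p (v (σ 0)) (v (σ 1)) (v (σ 2)) =
          (Equiv.Perm.sign σ : ℤ) • p (v 0) (v 1) (v 2)) ∧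
      -- with `B F G = ∑ p i j k • ∂ᵢF ∂ⱼG ∂ₖh` on the localization `A_{P'}` :
      (∀ F G : MvPolynomial (Fin n) ℂ,
        -- (i) `B` computes the localized Poisson bracket
        algebraMap _ (Localization.AtPrime P)
            (br (Ideal.Quotient.mk (Ideal.span {h}) F) (Ideal.Quotient.mk (Ideal.span {h}) G)) =
          Localization.localRingHom (P.comap (Ideal.Quotient.mk (Ideal.span {h}))) P
            (Ideal.Quotient.mk (Ideal.span {h})) rfl
            (∑ i : Fin n, ∑ j : Fin n, ∑ k : Fin n,
              p i j k * D i (algebraMap _ _ F) * D j (algebraMap _ _ G)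
                * D k (algebraMap _ _ h))) ∧
      -- (ii) the Jacobi identity for `B` holds up to a correction term divisible by `h`
      (∀ F₁ F₂ F₃ :
          Localization.AtPrime (P.comap (Ideal.Quotient.mk (Ideal.span {h}))),
        (fun F G => ∑ i : Fin n, ∑ j : Fin n, ∑ k : Fin n,
            p i j k * D i F * D j G * D k (algebraMap _ _ h))
            ((fun F G => ∑ i : Fin n, ∑ j : Fin n, ∑ k : Fin n,
              p i j k * D i F * D j G * D k (algebraMap _ _ h)) F₁ F₂) F₃ +
          (fun F G => ∑ i : Fin n, ∑ j : Fin n, ∑ k : Fin n,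
            p i j k * D i F * D j G * D k (algebraMap _ _ h))
            ((fun F G => ∑ i : Fin n, ∑ j : Fin n, ∑ k : Fin n,
              p i j k * D i F * D j G * D k (algebraMap _ _ h)) F₂ F₃) F₁ +
          (fun F G => ∑ i : Fin n, ∑ j : Fin n, ∑ k : Fin n,
            p i j k * D i F * D j G * D k (algebraMap _ _ h))
            ((fun F G => ∑ i : Fin n, ∑ j : Fin n, ∑ k : Fin n,
              p i j k * D i F * D j G * D k (algebraMap _ _ h)) F₃ F₁) F₂ =
        algebraMap (MvPolynomial (Fin n) ℂ) _ h *
          ∑ i : Fin n, ∑ j : Fin n, ∑ k : Fin n, ∑ l : Fin n,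
            q i j k l * D i F₁ * D j F₂ * D k F₃ * D l (algebraMap _ _ h)) := by
  have : NeZero n := ⟨by omega⟩
  have hh : h ≠ 0 := ne_zero_of_finite_quotient hsing
  have hK := koszulExactAbove_of_finite (fun i => pderiv i h) h
  obtain ⟨π₀, hanti, hdiag, hlift⟩ := hbr.exists_antisymm_lift (ι := Fin n)
    Ideal.Quotient.mk_surjective
  obtain ⟨p, hp, hpπ⟩ := hK.exists_alternating_of_matrix hh π₀ hanti hdiag fun j => by
    rw [← Ideal.Quotient.eq_zero_iff_mem, map_sum]
    have h1 := hbr.apply_algebraMap_right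
      (Ideal.Quotient.mk (Ideal.span {h}) (X j : MvPolynomial (Fin n) ℂ)) h
    have h2 : algebraMap (MvPolynomial (Fin n) ℂ) (MvPolynomial (Fin n) ℂ ⧸ Ideal.span {h}) h = 0 :=
      Ideal.Quotient.eq_zero_iff_mem.2 (Ideal.mem_span_singleton_self h)
    rw [h2, hbr.antisymm, hbr.zero_left, neg_zero] at h1
    rw [← neg_eq_zero, ← Finset.sum_neg_distrib]
    refine Eq.trans (Finset.sum_congr rfl fun i _ => ?_) h1.symm
    rw [map_mul, hanti, map_neg, mul_neg, neg_neg]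
    exact congrArg (_ * ·) (hlift j i)
  set π : Fin n → Fin n → MvPolynomial (Fin n) ℂ := fun i j => ∑ k, p i j k * pderiv k h with hπdef
  have hp01 := alternating_swap_left hp
  have hπ : ∀ i j, π i j = -π j i := fun i j => by
    simp only [hπdef]
    rw [← Finset.sum_neg_distrib]
    exact Finset.sum_congr rfl fun k _ => by rw [hp01, neg_mul]
  have hbrπ : ∀ F G, br (Ideal.Quotient.mk _ F) (Ideal.Quotient.mk _ G) =
      Ideal.Quotient.mk _ (bivectorBracket pderiv π F G) :=
    hbr.eq_bivectorBracket fun i j =>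
      (Ideal.Quotient.eq.2 (hpπ i j)).symm.trans (hlift i j)
  have hJ : ∀ F G E, jacobiator pderiv π F G E ∈ Ideal.span {h} := fun F G E => by
    rw [← Ideal.Quotient.eq_zero_iff_mem, jacobiator]
    simp only [map_add, ← hbrπ]
    exact hbr.cyclic_sum_left _ _ _
  obtain ⟨r, c, hr, hc⟩ := exists_jacobiator_eq hh hK hp01 (alternating_swap_right hp) hJ
  have hru : IsUnit (algebraMap (MvPolynomial (Fin n) ℂ)
      (Localization.AtPrime (P.comap (Ideal.Quotient.mk (Ideal.span {h})))) r) := by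
    refine IsLocalization.map_units _
      (⟨r, fun hrP => hP.ne_top ((Ideal.eq_top_iff_one P).2 ?_)⟩ :
        (P.comap (Ideal.Quotient.mk (Ideal.span {h}))).primeCompl)
    have h1 : Ideal.Quotient.mk (Ideal.span {h}) r = 1 := by
      rw [← map_one (Ideal.Quotient.mk (Ideal.span {h}))]
      exact Ideal.Quotient.eq.2 hr
    exact h1 ▸ Ideal.mem_comap.1 hrP
  obtain ⟨u, hu⟩ := hru.exists_left_inv
  have hB : ∀ F G : Localization.AtPrime (P.comap (Ideal.Quotient.mk (Ideal.span {h}))),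
      (∑ i : Fin n, ∑ j : Fin n, ∑ k : Fin n,
        algebraMap _ _ (p i j k) * D i F * D j G * D k (algebraMap _ _ h)) =
      bivectorBracket D (fun i j => algebraMap _ _ (π i j)) F G := fun F G => by
    refine Finset.sum_congr rfl fun i _ => Finset.sum_congr rfl fun j _ => ?_
    simp only [hπdef, map_sum, Finset.sum_mul, map_mul, hD]
    exact Finset.sum_congr rfl fun k _ => by ring
  refine ⟨fun i j k => algebraMap _ _ (p i j k), fun i j k l => u * algebraMap _ _ (c i j k l),
    fun σ v => ?_, fun F G => ?_, fun F₁ F₂ F₃ => ?_⟩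
  · simp only [hp σ v, map_zsmul]
  · rw [hB, map_bivectorBracket pderiv π _ D hD, Localization.localRingHom_to_map, hbrπ]
  · simp only [hB]
    exact jacobiator_eq_of_isLocalization
      (P.comap (Ideal.Quotient.mk (Ideal.span {h}))).primeCompl hD hπ hu hc F₁ F₂ F₃
end

section
/- Let n ≥ 3 and suppose the hypersurface h = 0 has isolated singularities. Let {-,-} be a Poisson bracket on O = A/(h) and let P be a prime ideal of O. Then for all u, v ∈ O, the element loc({u,v}) belongs to the ideal of O_P generated by the elements loc([∂₁h]), …, loc([∂ₙh]). -/
open MvPolynomial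

namespace AlternatingMap

variable {R M : Type*} [CommRing R] [AddCommGroup M] [Module R M]

/-- Contraction with a vector is a graded derivation with respect to left multiplication by a
linear form. -/
theorem curryLeft_alternatizeUncurryFin_smulRight {n : ℕ} (a : M →ₗ[R] R)
    (z : M [⋀^Fin (n + 1)]→ₗ[R] R) (f : M) :
    (alternatizeUncurryFin (a.smulRight z)).curryLeft f =
      a f • z - alternatizeUncurryFin (a.smulRight (z.curryLeft f)) := by
  ext v
  simp only [curryLeft_apply_apply, alternatizeUncurryFin_apply, sub_apply, smul_apply,
    LinearMap.smulRight_apply]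
  rw [Fin.sum_univ_succ, sub_eq_add_neg, ← Finset.sum_neg_distrib]
  congr 1
  · simp [Matrix.vecCons, Fin.removeNth_zero]
  · refine Finset.sum_congr rfl fun k _ => ?_
    have : k.succ.removeNth (Matrix.vecCons f v) = Matrix.vecCons f (k.removeNth v) := by
      ext j
      refine Fin.cases ?_ (fun j => ?_) j <;> simp [Fin.removeNth]
    simp [this, pow_succ]

/-- An alternating map with values in `K ⊔ (p)` is, modulo `K`, a multiple of `p`. -/
theorem exists_sub_mul_mem_of_forall_mem_sup [Module.Free R M] {n : ℕ} {K : Ideal R} {p : R}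
    (L : M [⋀^Fin n]→ₗ[R] R) (hL : ∀ v, L v ∈ K ⊔ Ideal.span {p}) :
    ∃ u : M [⋀^Fin n]→ₗ[R] R, ∀ v, L v - p * u v ∈ K := by
  let g : R →ₗ[R] R ⧸ K := K.mkQ ∘ₗ LinearMap.mulLeft R p
  have hmem : ∀ v, K.mkQ.compAlternatingMap L v ∈ LinearMap.range g := by
    intro v
    obtain ⟨k, hk, x, hx, hkx⟩ := Submodule.mem_sup.1 (hL v)
    obtain ⟨c, rfl⟩ := Ideal.mem_span_singleton'.1 hx
    refine ⟨c, ?_⟩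
    simp only [g, LinearMap.comp_apply, LinearMap.mulLeft_apply,
      LinearMap.compAlternatingMap_apply, Submodule.mkQ_apply]
    refine (Submodule.Quotient.eq K).2 ?_
    rw [← hkx]
    have : p * c - (k + c * p) = -k := by ring
    rw [this]
    exact K.neg_mem hk
  let L' := (K.mkQ.compAlternatingMap L).codRestrict (LinearMap.range g) hmem
  obtain ⟨F, hF⟩ := Module.projective_lifting_property g.rangeRestrict
    (exteriorPower.alternatingMapLinearEquiv L') g.surjective_rangeRestrict
  refine ⟨exteriorPower.alternatingMapLinearEquiv.symm F, fun v => ?_⟩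
  have h := congrArg Subtype.val (LinearMap.congr_fun hF (exteriorPower.ιMulti R n v))
  rw [exteriorPower.alternatingMapLinearEquiv_apply_ιMulti] at h
  exact (Submodule.Quotient.eq K).1 h.symm

/-- Exactness of the Koszul complex of `f` modulo `K`, in degree `n + 1`. -/
def KoszulExactAt (f : M) (K : Ideal R) (n : ℕ) : Prop :=
  ∀ z : M [⋀^Fin (n + 1)]→ₗ[R] R, (∀ v, z.curryLeft f v ∈ K) →
    ∃ y : M [⋀^Fin (n + 2)]→ₗ[R] R, ∀ v, z v - y.curryLeft f v ∈ K

theorem koszulExactAt_of_card_le {ι : Type*} [Fintype ι] (b : Module.Basis ι R M) (f : M)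
    (K : Ideal R) {n : ℕ} (hn : Fintype.card ι ≤ n) : KoszulExactAt f K n := by
  intro z _
  have hz : z = 0 := by
    refine b.ext_alternating fun v hv => ?_
    have := Fintype.card_le_of_injective v hv
    rw [Fintype.card_fin] at this
    omega
  exact ⟨0, fun v => by simp [hz]⟩

theorem KoszulExactAt.of_sup_span [Module.Free R M] {f : M} {K : Ideal R} {n : ℕ} (a : M →ₗ[R] R)
    (hreg : ∀ x, a f * x ∈ K → x ∈ K)
    (hex : KoszulExactAt f (K ⊔ Ideal.span {a f}) (n + 1)) : KoszulExactAt f K n := by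
  intro z hz
  set w := alternatizeUncurryFin (a.smulRight z) with hw
  have hwf : ∀ v, w.curryLeft f v - a f * z v ∈ K := by
    intro v
    rw [hw, curryLeft_alternatizeUncurryFin_smulRight, sub_apply, smul_apply, smul_eq_mul,
      sub_sub_cancel_left, alternatizeUncurryFin_apply]
    refine K.neg_mem (K.sum_mem fun k _ => ?_)
    rw [zsmul_eq_mul]
    refine K.mul_mem_left _ ?_
    rw [LinearMap.smulRight_apply, smul_apply]
    exact K.mul_mem_left _ (hz _)
  obtain ⟨y, hy⟩ := hex w fun v => by
    rw [← sub_add_cancel (w.curryLeft f v) (a f * z v)]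
    exact add_mem (Ideal.mem_sup_left (hwf v))
      (Ideal.mem_sup_right (Ideal.mul_mem_right _ _ (Ideal.mem_span_singleton_self _)))
  obtain ⟨u, hu⟩ := exists_sub_mul_mem_of_forall_mem_sup (w - y.curryLeft f) hy
  refine ⟨u, fun v => hreg _ ?_⟩
  have h1 := hu (Matrix.vecCons f v)
  have h2 : y.curryLeft f (Matrix.vecCons f v) = 0 := by
    rw [← curryLeft_apply_apply, curryLeft_same, zero_apply]
  rw [sub_apply, h2, sub_zero] at h1
  have h3 := K.sub_mem h1 (hwf v)
  simp only [curryLeft_apply_apply] at h3 ⊢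
  convert h3 using 1
  ring

/-- Depth sensitivity of the Koszul complex: if the ideal generated by the entries of `f` contains
a regular sequence of length `m`, then the Koszul complex of `f` is exact in all degrees larger
than the number of entries minus `m`. -/
theorem koszulExactAt_of_regular [Module.Free R M] {ι : Type*} [Fintype ι]
    (b : Module.Basis ι R M) (f : M) {m : ℕ} (a : Fin m → M →ₗ[R] R)
    (hreg : ∀ k x, a k f * x ∈ Ideal.span ((fun j => a j f) '' Set.Iio k) →
      x ∈ Ideal.span ((fun j => a j f) '' Set.Iio k))
    {n : ℕ} (hn : Fintype.card ι ≤ n + m) : KoszulExactAt f (⊥ : Ideal R) n := by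
  have key : ∀ d k n : ℕ, k + d = m → Fintype.card ι ≤ n + d →
      KoszulExactAt f (Ideal.span ((fun j => a j f) '' {j | j.val < k})) n := by
    intro d
    induction d with
    | zero => exact fun k n _ hn => koszulExactAt_of_card_le b f _ hn
    | succ d ih =>
      intro k n hk hn
      refine KoszulExactAt.of_sup_span (a ⟨k, by omega⟩) (hreg ⟨k, by omega⟩) ?_
      have := ih (k + 1) (n + 1) (by omega) (by omega)
      rwa [show {j : Fin m | j.val < k + 1} = {j | j.val < k} ∪ {⟨k, by omega⟩} by
        ext j; simp [Fin.ext_iff]; omega, Set.image_union, Ideal.span_union,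
        Set.image_singleton] at this
  simpa using key m 0 n (by omega) hn

/-- The alternating bilinear form with a given skew-symmetric matrix with zero diagonal. -/
def ofMatrix {ι R : Type*} [Fintype ι] [CommRing R] [IsDomain R] [CharZero R] (Z : Matrix ι ι R)
    (hZ : Z.transpose = -Z) : (ι → R) [⋀^Fin 2]→ₗ[R] R where
  toFun v := v 0 ⬝ᵥ Z.mulVec (v 1)
  map_update_add' v i x y := by
    fin_cases i <;> simp [Matrix.mulVec_add]
  map_update_smul' v i c x := by
    fin_cases i <;> simp [Matrix.mulVec_smul]
  map_eq_zero_of_eq' v i j hv hij := by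
    have h01 : v 0 = v 1 := by
      fin_cases i <;> fin_cases j <;> simp_all
    have h : v 1 ⬝ᵥ Z.mulVec (v 1) = -(v 1 ⬝ᵥ Z.mulVec (v 1)) := by
      conv_lhs => rw [Matrix.dotProduct_mulVec, ← Matrix.mulVec_transpose, hZ, Matrix.neg_mulVec,
        neg_dotProduct, dotProduct_comm]
    simpa [h01] using self_eq_neg.1 h
theorem ofMatrix_apply {ι R : Type*} [Fintype ι] [CommRing R] [IsDomain R] [CharZero R]
    (Z : Matrix ι ι R) (hZ : Z.transpose = -Z) (v : Fin 2 → ι → R) :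
    ofMatrix Z hZ v = v 0 ⬝ᵥ Z.mulVec (v 1) := rfl

theorem curryLeft_ofMatrix_eq_zero {ι R : Type*} [Fintype ι] [CommRing R] [IsDomain R] [CharZero R]
    {Z : Matrix ι ι R} (hZ : Z.transpose = -Z) {f : ι → R} (hf : Z.mulVec f = 0) :
    (ofMatrix Z hZ).curryLeft f = 0 := by
  ext v
  rw [curryLeft_apply_apply, ofMatrix_apply, Matrix.dotProduct_mulVec, ← Matrix.mulVec_transpose,
    hZ, Matrix.neg_mulVec]
  simp [hf]

theorem curryLeft_apply_mem_span_range {ι R : Type*} [Finite ι] [CommRing R] {n : ℕ}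
    (y : (ι → R) [⋀^Fin (n + 1)]→ₗ[R] R) (f : ι → R) (v : Fin n → ι → R) :
    y.curryLeft f v ∈ Ideal.span (Set.range f) := by
  classical
  have := Fintype.ofFinite ι
  let φ : (ι → R) →ₗ[R] R :=
    { toFun := fun x => y.curryLeft x v
      map_add' := by simp
      map_smul' := by simp }
  change φ f ∈ _
  rw [LinearMap.pi_apply_eq_sum_univ φ f]
  refine Ideal.sum_mem _ fun i _ => ?_
  rw [smul_eq_mul]
  exact Ideal.mul_mem_right _ _ (Ideal.subset_span ⟨i, rfl⟩)

end AlternatingMap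

/-- A monic polynomial in one variable is a nonzerodivisor modulo any ideal generated by
polynomials in the other variables. -/
theorem MvPolynomial.mem_span_of_aeval_X_mul_mem {σ R : Type*} [CommRing R] (q : σ → Polynomial R)
    (k : σ) (hq : (q k).Monic) (s : Set σ) (hs : k ∉ s) {x : MvPolynomial σ R}
    (hx : Polynomial.aeval (X k) (q k) * x ∈
      Ideal.span ((fun j => Polynomial.aeval (X j : MvPolynomial σ R) (q j)) '' s)) :
    x ∈ Ideal.span ((fun j => Polynomial.aeval (X j : MvPolynomial σ R) (q j)) '' s) := by
  classical
  let e : MvPolynomial σ R ≃ₐ[R] Polynomial (MvPolynomial {j // j ≠ k} R) :=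
    (renameEquiv R (Equiv.optionSubtypeNe k).symm).trans (optionEquivLeft R _)
  have hek : e (X k) = Polynomial.X := by simp [e]
  have hej : ∀ j (hj : j ≠ k), e (X j) = Polynomial.C (X ⟨j, hj⟩) := by
    intro j hj
    simp [e, Equiv.optionSubtypeNe_symm_of_ne hj]
  let I : Ideal (MvPolynomial {j // j ≠ k} R) :=
    Ideal.span ((fun j => Polynomial.aeval (X j) (q j.1)) '' {j | j.1 ∈ s})
  have hI : (Ideal.span ((fun j => Polynomial.aeval (X j : MvPolynomial σ R) (q j)) '' s)).map e =
      I.map Polynomial.C := by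
    simp only [I, Ideal.map_span, ← Set.image_comp]
    congr 1
    ext y
    constructor
    · rintro ⟨j, hj, rfl⟩
      have hjk : j ≠ k := fun h => hs (h ▸ hj)
      refine ⟨⟨j, hjk⟩, hj, ?_⟩
      simp only [Function.comp_apply]
      rw [← Polynomial.aeval_algHom_apply e, hej j hjk]
      exact (Polynomial.aeval_algHom_apply (Polynomial.CAlgHom (R := R)) _ _).symm
    · rintro ⟨j, hj, rfl⟩
      refine ⟨j, hj, ?_⟩
      simp only [Function.comp_apply]
      rw [← Polynomial.aeval_algHom_apply e, hej j.1 j.2]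
      exact (Polynomial.aeval_algHom_apply (Polynomial.CAlgHom (R := R)) _ _)
  have hmem : ∀ y, y ∈ Ideal.span
      ((fun j => Polynomial.aeval (X j : MvPolynomial σ R) (q j)) '' s) ↔
      (e y).map (Ideal.Quotient.mk I) = 0 := by
    intro y
    rw [← Polynomial.coe_mapRingHom, ← RingHom.mem_ker, Polynomial.ker_mapRingHom,
      Ideal.mk_ker, ← hI, ← Ideal.mem_comap, Ideal.comap_map_of_bijective e e.bijective]
  rw [hmem] at hx ⊢
  rw [map_mul, Polynomial.map_mul, ← Polynomial.aeval_algHom_apply, hek] at hx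
  have : Polynomial.aeval (Polynomial.X : Polynomial (MvPolynomial {j // j ≠ k} R)) (q k) =
      (q k).map (algebraMap R _) := by
    rw [← Polynomial.aeval_map_algebraMap (MvPolynomial {j // j ≠ k} R), Polynomial.aeval_X_left_apply]
  rw [this] at hx
  exact (((hq.map _).map (Ideal.Quotient.mk I)).mul_right_eq_zero_iff).1 hx

theorem MvPolynomial.derivation_eq_sum_pderiv_s3 {σ R B : Type*} [Fintype σ] [CommRing R]
    [AddCommGroup B] [Module R B] [Module (MvPolynomial σ R) B]
    [IsScalarTower R (MvPolynomial σ R) B]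
    (D : Derivation R (MvPolynomial σ R) B) (F : MvPolynomial σ R) :
    D F = ∑ j, pderiv j F • D (X j) := by
  classical
  induction F using MvPolynomial.induction_on with
  | C a => simp
  | add p q hp hq => simp [hp, hq, add_smul, Finset.sum_add_distrib]
  | mul_X p i hp =>
    simp [Derivation.leibniz, hp, pderiv_X, Pi.single_apply, add_smul, Finset.sum_add_distrib,
      Finset.smul_sum, smul_smul, ite_smul, mul_ite]

/-- If `I` has finite codimension, it contains a monic polynomial in each variable. -/
theorem MvPolynomial.exists_monic_aeval_X_mem {σ k : Type*} [Field k] (I : Ideal (MvPolynomial σ k))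
    [FiniteDimensional k (MvPolynomial σ k ⧸ I)] (i : σ) :
    ∃ q : Polynomial k, q.Monic ∧ Polynomial.aeval (X i : MvPolynomial σ k) q ∈ I := by
  obtain ⟨q, hq, h⟩ := Algebra.IsIntegral.isIntegral (R := k) (Ideal.Quotient.mk I (X i))
  refine ⟨q, hq, Ideal.Quotient.eq_zero_iff_mem.1 ?_⟩
  rw [← Ideal.Quotient.mkₐ_eq_mk k, ← Polynomial.aeval_algHom_apply]
  exact h

/-- If `g` consists of at most `n + 1` polynomials in `n` variables, generating an ideal of finite
codimension, the entries of a skew-symmetric matrix killing `g` lie in the ideal generated by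
`g`. -/
theorem MvPolynomial.mem_span_range_of_mulVec_eq_zero {n : ℕ} {k ι : Type*} [Field k] [CharZero k]
    [Fintype ι] (hι : Fintype.card ι ≤ n + 1) (g : ι → MvPolynomial (Fin n) k)
    [FiniteDimensional k (MvPolynomial (Fin n) k ⧸ Ideal.span (Set.range g))]
    (Z : Matrix ι ι (MvPolynomial (Fin n) k)) (hZ : Z.transpose = -Z) (hg : Z.mulVec g = 0)
    (i j : ι) : Z i j ∈ Ideal.span (Set.range g) := by
  classical
  choose q hq hqI using exists_monic_aeval_X_mem (Ideal.span (Set.range g))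
  choose c hc using fun l => Ideal.mem_span_range_iff_exists_fun.1 (hqI l)
  have ha : ∀ l, (∑ i, c l i • LinearMap.proj (R := MvPolynomial (Fin n) k)
      (φ := fun _ : ι => MvPolynomial (Fin n) k) i) g = Polynomial.aeval (X l) (q l) := by
    intro l
    rw [← hc l]
    simp
  have hex := AlternatingMap.koszulExactAt_of_regular (Pi.basisFun (MvPolynomial (Fin n) k) ι) g
    (fun l => ∑ i, c l i • LinearMap.proj i)
    (by
      intro l x hx
      simp only [ha] at hx ⊢
      exact mem_span_of_aeval_X_mul_mem q l (hq l) _ (by simp) hx)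
    (n := 1) (by omega)
  obtain ⟨y, hy⟩ := hex (AlternatingMap.ofMatrix Z hZ) fun v => by
    rw [AlternatingMap.curryLeft_ofMatrix_eq_zero hZ hg]
    simp
  have h := hy ![Pi.single i 1, Pi.single j 1]
  rw [Ideal.mem_bot, sub_eq_zero, AlternatingMap.ofMatrix_apply] at h
  simp only [Matrix.cons_val_zero, Matrix.cons_val_one, Matrix.mulVec_single_one,
    single_one_dotProduct, Matrix.col_apply] at h
  rw [h]
  exact AlternatingMap.curryLeft_apply_mem_span_range y g _

/-- On a hypersurface with isolated singularities, a bivector tangent to the hypersurface has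
coefficients in the Jacobian ideal. -/
theorem MvPolynomial.mem_jacobian_of_skew {n : ℕ} {k : Type*} [Field k] [CharZero k]
    {h : MvPolynomial (Fin n) k} (hh : h ≠ 0)
    [FiniteDimensional k (MvPolynomial (Fin n) k ⧸
      Ideal.span (insert h (Set.range fun i => pderiv i h)))]
    (B : Matrix (Fin n) (Fin n) (MvPolynomial (Fin n) k)) (hB : B.transpose = -B)
    (hBh : ∀ i, ∑ j, B i j * pderiv j h ∈ Ideal.span {h}) (i j : Fin n) :
    B i j ∈ Ideal.span (insert h (Set.range fun i => pderiv i h)) := by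
  choose a ha using fun i => Ideal.mem_span_singleton'.1 (hBh i)
  let g : Option (Fin n) → MvPolynomial (Fin n) k := fun o => o.elim h fun i => pderiv i h
  have hg : insert h (Set.range fun i => pderiv i h) = Set.range g := by
    ext x
    simp [g, Option.exists, eq_comm]
  have hB' : ∀ i j, B j i = -B i j := fun i j => congrFun (congrFun hB i) j
  let Z : Matrix (Option (Fin n)) (Option (Fin n)) (MvPolynomial (Fin n) k) := fun o o' =>
    o.elim (o'.elim 0 a) fun i => o'.elim (-a i) (B i)
  have hZ : Z.transpose = -Z := by
    ext1 o o'
    change Z o' o = -Z o o'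
    rcases o with _ | i <;> rcases o' with _ | j
    · simp [Z]
    · simp [Z]
    · simp [Z]
    · exact hB' i j
  have hsum : h * ∑ j, a j * pderiv j h = 0 := by
    refine self_eq_neg.1 ?_
    have e : h * ∑ j, a j * pderiv j h = ∑ i, ∑ j, B i j * pderiv j h * pderiv i h := by
      rw [Finset.mul_sum]
      refine Finset.sum_congr rfl fun i _ => ?_
      rw [← Finset.sum_mul, ← ha]
      ring
    rw [e]
    conv_lhs => rw [Finset.sum_comm]
    simp only [← Finset.sum_neg_distrib]
    refine Finset.sum_congr rfl fun i _ => Finset.sum_congr rfl fun j _ => ?_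
    rw [hB' i j]
    ring
  have hZg : Z.mulVec g = 0 := by
    ext1 o
    cases o with
    | none => simpa [Z, g, Matrix.mulVec, dotProduct, hh] using hsum
    | some i => simp [Z, g, Matrix.mulVec, dotProduct, ← ha i]
  have : FiniteDimensional k (MvPolynomial (Fin n) k ⧸ Ideal.span (Set.range g)) := by
    rwa [← hg]
  rw [hg]
  exact mem_span_range_of_mulVec_eq_zero (by simp) g Z hZ hZg (some i) (some j)

theorem MvPolynomial.ne_zero_of_finiteDimensional_jacobian {σ k : Type*} [Nonempty σ] [Field k]
    {h : MvPolynomial σ k}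
    [FiniteDimensional k (MvPolynomial σ k ⧸
      Ideal.span (insert h (Set.range fun i => pderiv i h)))] : h ≠ 0 := by
  rintro rfl
  obtain ⟨i⟩ := ‹Nonempty σ›
  obtain ⟨q, hq, hqI⟩ := exists_monic_aeval_X_mem
    (Ideal.span (insert (0 : MvPolynomial σ k) (Set.range fun i => pderiv i 0))) i
  have hbot : Ideal.span (insert (0 : MvPolynomial σ k) (Set.range fun i => pderiv i 0)) = ⊥ := by
    rw [Ideal.span_eq_bot]
    simp
  rw [hbot, Ideal.mem_bot] at hqI
  exact transcendental_X k i ⟨q, hq.ne_zero, hqI⟩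

namespace IsPoissonBracket

/-- The Hamiltonian derivation of `u`, pulled back along an algebra map. -/
def hamiltonian {S R : Type*} [CommRing S] [Algebra ℂ S] [CommRing R] [Algebra ℂ R] [Algebra S R]
    [IsScalarTower ℂ S R] {br : R → R → R} (hbr : IsPoissonBracket br) (u : R) :
    Derivation ℂ S R :=
  Derivation.mk'
    { toFun := fun F => br u (algebraMap S R F)
      map_add' := fun F G => by simpa using hbr.2.1 1 u (algebraMap S R F) (algebraMap S R G)
      map_smul' := fun c F => by
        have h0 : br u 0 = 0 := by simpa using hbr.2.1 1 u 0 0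
        simpa [h0, Algebra.algebraMap_eq_smul_one] using hbr.2.1 c u (algebraMap S R F) 0 }
    fun F G => by
      simp only [LinearMap.coe_mk, AddHom.coe_mk, map_mul, hbr.2.2.2.1, Algebra.smul_def]
      ring

theorem hamiltonian_apply {S R : Type*} [CommRing S] [Algebra ℂ S] [CommRing R] [Algebra ℂ R]
    [Algebra S R] [IsScalarTower ℂ S R] {br : R → R → R} (hbr : IsPoissonBracket br) (u : R)
    (F : S) : hbr.hamiltonian u F = br u (algebraMap S R F) := rfl

/-- A Poisson bracket is determined by the brackets of the coordinates. -/
theorem mem_of_forall_X {σ R : Type*} [Fintype σ] [CommRing R] [Algebra ℂ R]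
    [Algebra (MvPolynomial σ ℂ) R] [IsScalarTower ℂ (MvPolynomial σ ℂ) R] {br : R → R → R}
    (hbr : IsPoissonBracket br) (hsurj : Function.Surjective (algebraMap (MvPolynomial σ ℂ) R))
    {J : Ideal R}
    (hJ : ∀ i j, br (algebraMap (MvPolynomial σ ℂ) R (X i))
      (algebraMap (MvPolynomial σ ℂ) R (X j)) ∈ J) (u v : R) : br u v ∈ J := by
  have key : ∀ u, (∀ j, br u (algebraMap (MvPolynomial σ ℂ) R (X j)) ∈ J) → ∀ v, br u v ∈ J := by
    intro u hu v
    obtain ⟨F, rfl⟩ := hsurj v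
    rw [← hbr.hamiltonian_apply u F, derivation_eq_sum_pderiv_s3]
    refine J.sum_mem fun j _ => ?_
    rw [Algebra.smul_def]
    exact J.mul_mem_left _ (hu j)
  refine key u (fun j => ?_) v
  rw [hbr.2.2.1]
  exact J.neg_mem (key _ (hJ j) u)

end IsPoissonBracket

/-- The global form of the theorem below: brackets lie in the Jacobian ideal of the hypersurface. -/
theorem IsPoissonBracket.mem_map_jacobian {n : ℕ} [NeZero n] {h : MvPolynomial (Fin n) ℂ}
    [FiniteDimensional ℂ (MvPolynomial (Fin n) ℂ ⧸
      Ideal.span (insert h (Set.range fun i => pderiv i h)))]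
    {br : (MvPolynomial (Fin n) ℂ ⧸ Ideal.span {h}) →
      (MvPolynomial (Fin n) ℂ ⧸ Ideal.span {h}) → (MvPolynomial (Fin n) ℂ ⧸ Ideal.span {h})}
    (hbr : IsPoissonBracket br) (u v : MvPolynomial (Fin n) ℂ ⧸ Ideal.span {h}) :
    br u v ∈ Ideal.span
      (Set.range fun i => Ideal.Quotient.mk (Ideal.span {h}) (pderiv i h)) := by
  let π := Ideal.Quotient.mk (Ideal.span {h})
  refine hbr.mem_of_forall_X Ideal.Quotient.mk_surjective (fun i j => ?_) u v
  choose L hL using fun i j : Fin n =>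
    Ideal.Quotient.mk_surjective (I := Ideal.span {h}) (br (π (X i)) (π (X j)))
  let B : Matrix (Fin n) (Fin n) (MvPolynomial (Fin n) ℂ) :=
    fun i j => (1 / 2 : ℂ) • (L i j - L j i)
  have hπB : ∀ i j, π (B i j) = br (π (X i)) (π (X j)) := by
    intro i j
    have : π (B i j) = (1 / 2 : ℂ) • (π (L i j) - π (L j i)) := by
      rw [← map_sub]
      rfl
    rw [this, hL, hL, hbr.2.2.1 (π (X j)), sub_neg_eq_add, ← two_smul ℂ, smul_smul]
    norm_num
  have hB : B.transpose = -B := by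
    ext1 i j
    change B j i = -B i j
    simp only [B, ← smul_neg, neg_sub]
  have hmem := mem_jacobian_of_skew (ne_zero_of_finiteDimensional_jacobian (h := h)) B hB
    (fun i => by
      rw [← Ideal.Quotient.eq_zero_iff_mem, map_sum]
      have h0 := derivation_eq_sum_pderiv_s3 (hbr.hamiltonian (π (X i))) h
      rw [hbr.hamiltonian_apply, Ideal.Quotient.algebraMap_eq,
        Ideal.Quotient.eq_zero_iff_mem.2 (Ideal.mem_span_singleton_self h)] at h0
      have hz : br (π (X i)) 0 = 0 := by simpa using hbr.2.1 1 (π (X i)) 0 0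
      rw [hz] at h0
      rw [h0]
      refine Finset.sum_congr rfl fun j _ => ?_
      rw [map_mul, hbr.hamiltonian_apply, Algebra.smul_def, mul_comm]
      exact congrArg _ (hπB i j)) i j
  have := Ideal.mem_map_of_mem π hmem
  rw [Ideal.map_span, Set.image_insert_eq, ← Set.range_comp, hπB,
    show π h = 0 from Ideal.Quotient.eq_zero_iff_mem.2 (Ideal.mem_span_singleton_self h),
    Ideal.span_insert_zero] at this
  exact this

theorem poisson_bracket_mem_jacobian_ideal_hypersurface
    (n : ℕ) (hn : 3 ≤ n) (h : MvPolynomial (Fin n) ℂ)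
    -- the hypersurface `h = 0` has isolated singularities
    (hsing : FiniteDimensional ℂ
      ((MvPolynomial (Fin n) ℂ) ⧸
        Ideal.span (insert h (Set.range fun i => pderiv i h))))
    (br : (MvPolynomial (Fin n) ℂ ⧸ Ideal.span {h}) →
      (MvPolynomial (Fin n) ℂ ⧸ Ideal.span {h}) →
      (MvPolynomial (Fin n) ℂ ⧸ Ideal.span {h}))
    (hbr : IsPoissonBracket br)
    (P : Ideal (MvPolynomial (Fin n) ℂ ⧸ Ideal.span {h})) (hP : P.IsPrime) :
    ∀ u v : MvPolynomial (Fin n) ℂ ⧸ Ideal.span {h},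
      algebraMap _ (Localization.AtPrime P) (br u v) ∈
        Ideal.span (Set.range fun i : Fin n =>
          algebraMap _ (Localization.AtPrime P)
            (Ideal.Quotient.mk (Ideal.span {h}) (pderiv i h))) := by
  intro u v
  have : NeZero n := ⟨by omega⟩
  have hmem := Ideal.mem_map_of_mem (algebraMap _ (Localization.AtPrime P))
    (hbr.mem_map_jacobian u v)
  rwa [Ideal.map_span, ← Set.range_comp] at hmem
end
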